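/- Let Ω be a simply connected Runge domain in ℂ² and let h be a real-valued pluriharmonic function on Ω. Let M := { z ∈ Ω : h(z) = 0 } and assume dh(z) ≠ 0 for all z ∈ M. Then every totally real C²-smooth disc contained in M is polynomially convex. -/

import Mathlib

noncomputable section

/-- The polynomial (convex) hull of a set `K ⊆ ℂⁿ`:
`K̂ = { z : |p(z)| ≤ sup_K |p| for every holomorphic polynomial p }`. -/
def polyHull (n : ℕ) (K : Set (Fin n → ℂ)) : Set (Fin n → ℂ) :=
  {z | ∀ p : MvPolynomial (Fin n) ℂ,
    ‖MvPolynomial.eval z p‖ ≤ sSup ((fun w => ‖MvPolynomial.eval w p‖) '' K)}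

/-- A set `K ⊆ ℂⁿ` is polynomially convex if it equals its polynomial hull. -/
def PolyConvex (n : ℕ) (K : Set (Fin n → ℂ)) : Prop := polyHull n K = K

/-- A Runge domain in `ℂⁿ`: a domain on which every holomorphic function can be
approximated uniformly on compact subsets by holomorphic polynomials. -/
def RungeDomain (n : ℕ) (Ω : Set (Fin n → ℂ)) : Prop :=
  IsOpen Ω ∧ IsConnected Ω ∧
  ∀ f : (Fin n → ℂ) → ℂ, DifferentiableOn ℂ f Ω →
    ∀ K : Set (Fin n → ℂ), K ⊆ Ω → IsCompact K → ∀ ε : ℝ, 0 < ε →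
      ∃ p : MvPolynomial (Fin n) ℂ, ∀ z ∈ K, ‖f z - MvPolynomial.eval z p‖ ≤ ε

/-- `K ⊆ ℂⁿ` is a totally real `C²`-smooth disc: the image of the closed unit
disc in `ℝ²` under a `C²` embedding `φ` (defined on an open neighborhood `U` of
the closed disc) whose image is a totally real submanifold, i.e. at each point
the tangent plane `W = range (dφ)` satisfies `W ∩ i·W = {0}`. -/
def TotallyRealDisc (n : ℕ) (K : Set (Fin n → ℂ)) : Prop :=
  ∃ (U : Set (ℝ × ℝ)) (φ : ℝ × ℝ → (Fin n → ℂ)),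
    IsOpen U ∧ Metric.closedBall (0 : ℝ × ℝ) 1 ⊆ U ∧
    ContDiffOn ℝ 2 φ U ∧ Set.InjOn φ U ∧
    (∀ x ∈ U, Function.Injective (fderiv ℝ φ x)) ∧
    (∀ x ∈ U, ∀ v w : ℝ × ℝ,
      fderiv ℝ φ x v = Complex.I • fderiv ℝ φ x w → fderiv ℝ φ x v = 0) ∧
    K = φ '' Metric.closedBall (0 : ℝ × ℝ) 1

open Topology Filter Set

lemma mem_polyHull_iff {n : ℕ} {K : Set (Fin n → ℂ)} (hK : IsCompact K) {z : Fin n → ℂ} :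
    z ∈ polyHull n K ↔ ∀ (p : MvPolynomial (Fin n) ℂ) (C : ℝ),
      (∀ w ∈ K, ‖MvPolynomial.eval w p‖ ≤ C) → ‖MvPolynomial.eval z p‖ ≤ C := by
  have hbdd (p : MvPolynomial (Fin n) ℂ) :
      BddAbove ((fun w => ‖MvPolynomial.eval w p‖) '' K) :=
    (hK.image (MvPolynomial.continuous_eval p).norm).bddAbove
  constructor
  · intro hz p C hC
    rcases K.eq_empty_or_nonempty with rfl | hne
    · have := hz 1
      simp at this
      linarith
    · refine (hz p).trans (csSup_le (hne.image _) ?_)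
      rintro _ ⟨w, hw, rfl⟩
      exact hC w hw
  · intro h p
    exact h p _ fun w hw => le_csSup (hbdd p) ⟨w, hw, rfl⟩

lemma subset_polyHull {n : ℕ} {K : Set (Fin n → ℂ)} (hK : IsCompact K) :
    K ⊆ polyHull n K :=
  fun z hz => (mem_polyHull_iff hK).2 fun _ _ h => h z hz

lemma isClosed_polyHull {n : ℕ} {K : Set (Fin n → ℂ)} : IsClosed (polyHull n K) := by
  have : polyHull n K = ⋂ p : MvPolynomial (Fin n) ℂ, {z | ‖MvPolynomial.eval z p‖ ≤
      sSup ((fun w => ‖MvPolynomial.eval w p‖) '' K)} := by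
    ext z; simp [polyHull]
  rw [this]
  exact isClosed_iInter fun p =>
    isClosed_le (MvPolynomial.continuous_eval p).norm continuous_const

lemma isCompact_polyHull {n : ℕ} {K : Set (Fin n → ℂ)} :
    IsCompact (polyHull n K) := by
  refine Metric.isCompact_of_isClosed_isBounded isClosed_polyHull ?_
  have : polyHull n K ⊆ Set.pi univ fun i => Metric.closedBall (0 : ℂ)
      (sSup ((fun w => ‖MvPolynomial.eval w (MvPolynomial.X i : MvPolynomial (Fin n) ℂ)‖) '' K)) := by
    intro z hz i _
    simpa using hz (MvPolynomial.X i)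
  exact (Bornology.IsBounded.pi fun i => Metric.isBounded_closedBall).subset this

lemma polyHull_mono {n : ℕ} {K L : Set (Fin n → ℂ)} (hK : IsCompact K) (hL : IsCompact L)
    (h : K ⊆ polyHull n L) : polyHull n K ⊆ polyHull n L := fun _ hz =>
  (mem_polyHull_iff hL).2 fun p C hC => (mem_polyHull_iff hK).1 hz p C fun _ hw =>
    (mem_polyHull_iff hL).1 (h hw) p C hC

/-- Restriction of polynomials to a set, as continuous functions. -/
def polyRestrict {n : ℕ} (K : Set (Fin n → ℂ)) : MvPolynomial (Fin n) ℂ →ₐ[ℂ] C(K, ℂ) :=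
  MvPolynomial.aeval fun i => ⟨fun w => w.1 i, (continuous_apply i).comp continuous_subtype_val⟩

lemma polyRestrict_apply {n : ℕ} (K : Set (Fin n → ℂ)) (p : MvPolynomial (Fin n) ℂ) (w : K) :
    polyRestrict K p w = MvPolynomial.eval w.1 p := by
  induction p using MvPolynomial.induction_on with
  | C a => simp [polyRestrict]
  | add p q hp hq => simp [hp, hq]
  | mul_X p i hp => simp [hp]; left; simp [polyRestrict]

/-- The uniform algebra `P(K)` generated by the polynomials. -/
abbrev polyAlgebra {n : ℕ} (K : Set (Fin n → ℂ)) [CompactSpace K] : Subalgebra ℂ C(K, ℂ) :=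
  (polyRestrict K).range.topologicalClosure

instance {n : ℕ} (K : Set (Fin n → ℂ)) [CompactSpace K] : CompleteSpace (polyAlgebra K) :=
  (Subalgebra.isClosed_topologicalClosure _).completeSpace_coe

/-- A polynomial as an element of `P(K)`. -/
def polyIncl {n : ℕ} (K : Set (Fin n → ℂ)) [CompactSpace K] :
    MvPolynomial (Fin n) ℂ →ₐ[ℂ] polyAlgebra K :=
  (polyRestrict K).codRestrict _ fun p =>
    Subalgebra.le_topologicalClosure _ ⟨p, rfl⟩

lemma denseRange_polyIncl {n : ℕ} (K : Set (Fin n → ℂ)) [CompactSpace K] :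
    DenseRange (polyIncl K) := by
  rintro ⟨a, ha⟩
  rw [closure_subtype]
  have : Subtype.val '' range (polyIncl K) = ((polyRestrict K).range : Set C(K, ℂ)) := by
    ext f
    simp [polyIncl]
  rw [this]
  exact ha

lemma norm_polyIncl_le {n : ℕ} {K : Set (Fin n → ℂ)} [CompactSpace K]
    {p : MvPolynomial (Fin n) ℂ} {C : ℝ} (hC0 : 0 ≤ C)
    (hC : ∀ w ∈ K, ‖MvPolynomial.eval w p‖ ≤ C) : ‖polyIncl K p‖ ≤ C := by
  change ‖polyRestrict K p‖ ≤ C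
  rw [ContinuousMap.norm_le _ hC0]
  intro w
  rw [polyRestrict_apply]
  exact hC w w.2

lemma norm_eval_le_norm_polyIncl {n : ℕ} {K : Set (Fin n → ℂ)} [CompactSpace K]
    (p : MvPolynomial (Fin n) ℂ) {z : Fin n → ℂ} (hz : z ∈ polyHull n K) :
    ‖MvPolynomial.eval z p‖ ≤ ‖polyIncl K p‖ := by
  refine (mem_polyHull_iff (isCompact_iff_compactSpace.2 inferInstance)).1 hz p _ fun w hw => ?_
  rw [← polyRestrict_apply K p ⟨w, hw⟩]
  exact ContinuousMap.norm_coe_le_norm (polyRestrict K p) _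

lemma exists_mem_polyHull_of_algHom {n : ℕ} {K : Set (Fin n → ℂ)} [CompactSpace K]
    (χ : polyAlgebra K →ₐ[ℂ] ℂ) :
    ∃ x ∈ polyHull n K, ∀ p, χ (polyIncl K p) = MvPolynomial.eval x p := by
  let x : Fin n → ℂ := fun i => χ (polyIncl K (MvPolynomial.X i))
  have hx : ∀ p, χ (polyIncl K p) = MvPolynomial.eval x p := by
    intro p
    have : (χ.comp (polyIncl K)) = MvPolynomial.aeval x := by
      apply MvPolynomial.algHom_ext
      intro i
      simp [x]
    have h2 := congrArg (fun f => f p) this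
    simpa [MvPolynomial.aeval_eq_eval] using h2
  refine ⟨x, (mem_polyHull_iff (isCompact_iff_compactSpace.2 inferInstance)).2 ?_, hx⟩
  intro p C hC
  rcases K.eq_empty_or_nonempty with hK | ⟨w, hw⟩
  · exfalso
    have h01 : (1 : polyAlgebra K) = 0 := by
      apply Subtype.ext
      ext w
      exact absurd w.2 (by simp [hK])
    have := congrArg χ h01
    simp at this
  · have hC0 : 0 ≤ C := (norm_nonneg _).trans (hC w hw)
    rw [← hx]
    refine (AlgHom.norm_apply_le_self_mul_norm_one χ _).trans ?_
    have h1 : ‖(1 : polyAlgebra K)‖ ≤ 1 := by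
      rw [← map_one (polyIncl K)]
      exact norm_polyIncl_le zero_le_one (by simp)
    calc ‖polyIncl K p‖ * ‖(1 : polyAlgebra K)‖ ≤ C * 1 := by
          gcongr
          exact norm_polyIncl_le hC0 hC
      _ = C := mul_one C


section BanachAlgebra

variable {A : Type*} [NormedCommRing A] [NormedAlgebra ℂ A] [CompleteSpace A]

lemma isUnit_of_forall_algHom_ne_zero {a : A} (h : ∀ χ : A →ₐ[ℂ] ℂ, χ a ≠ 0) : IsUnit a := by
  by_contra hu
  obtain ⟨χ, hχ⟩ := WeakDual.CharacterSpace.exists_apply_eq_zero hu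
  exact h (WeakDual.CharacterSpace.toAlgHom χ) hχ

lemma exists_norm_pow_lt {Q : A} {m : ℝ} (hm : 0 < m) (h : ∀ χ : A →ₐ[ℂ] ℂ, ‖χ Q‖ < m) :
    ∃ k : ℕ, 0 < k ∧ ‖Q ^ k‖ < m ^ k := by
  rcases subsingleton_or_nontrivial A with hs | hn
  · refine ⟨1, one_pos, ?_⟩
    rw [Subsingleton.elim (Q ^ 1) 0, norm_zero]
    positivity
  · have hr : spectralRadius ℂ Q < ENNReal.ofReal m := by
      obtain ⟨s, hs, hsr⟩ := spectrum.exists_nnnorm_eq_spectralRadius Q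
      rw [← hsr]
      obtain ⟨χ, hχ⟩ := WeakDual.CharacterSpace.mem_spectrum_iff_exists.1 hs
      have h5 : ‖s‖ < m := by rw [← hχ]; exact h (WeakDual.CharacterSpace.toAlgHom χ)
      have h6 : ((‖s‖₊ : NNReal) : ENNReal) = ENNReal.ofReal ‖s‖ := by
        rw [ENNReal.ofReal_eq_coe_nnreal (norm_nonneg _)]; rfl
      rw [h6]
      exact (ENNReal.ofReal_lt_ofReal_iff hm).2 h5
    have ht := spectrum.pow_norm_pow_one_div_tendsto_nhds_spectralRadius Q
    obtain ⟨k, hk, hk1⟩ := ((ht.eventually (gt_mem_nhds hr)).and (eventually_gt_atTop 0)).exists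
    refine ⟨k, hk1, ?_⟩
    rw [ENNReal.ofReal_lt_ofReal_iff hm] at hk
    have hk' : (0 : ℝ) < k := by exact_mod_cast hk1
    have := Real.rpow_lt_rpow (by positivity) hk hk'
    rwa [← Real.rpow_mul (norm_nonneg _), one_div, inv_mul_cancel₀ hk'.ne', Real.rpow_one,
      Real.rpow_natCast] at this

lemma exists_norm_pow_sub_mul_lt (a Q : A) {m : ℝ} (hm : 0 < m)
    (h : ∀ χ : A →ₐ[ℂ] ℂ, χ a = 0 → ‖χ Q‖ < m) :
    ∃ k : ℕ, 0 < k ∧ ∃ b : A, ‖Q ^ k - b * a‖ < m ^ k := by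
  let I : Ideal A := (Ideal.span {a}).closure
  have hIcl : IsClosed (I : Set A) := by
    simp only [I, Ideal.coe_closure]; exact isClosed_closure
  have hcomp : CompleteSpace (A ⧸ I) :=
    inferInstanceAs (CompleteSpace (A ⧸ I.toAddSubgroup))
  have ha : Ideal.Quotient.mk I a = 0 :=
    Ideal.Quotient.eq_zero_iff_mem.2 (subset_closure (Ideal.subset_span rfl))
  obtain ⟨k, hk, hkm⟩ := exists_norm_pow_lt (A := A ⧸ I) (Q := Ideal.Quotient.mk I Q) hm
    fun χ => h (χ.comp (Ideal.Quotient.mkₐ ℂ I)) (by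
      simp only [AlgHom.comp_apply, Ideal.Quotient.mkₐ_eq_mk, ha, map_zero])
  refine ⟨k, hk, ?_⟩
  obtain ⟨y, hy, hym⟩ := Ideal.Quotient.norm_mk_lt (I := I) (Ideal.Quotient.mk I Q ^ k)
    (sub_pos.2 hkm)
  have hyI : Q ^ k - y ∈ I := by
    rw [← Ideal.Quotient.eq_zero_iff_mem, map_sub, map_pow, hy, sub_self]
  have hyI' : Q ^ k - y ∈ closure ((Ideal.span {a} : Ideal A) : Set A) := hyI
  have hlt : ‖y‖ < m ^ k := by linarith
  have ho : IsOpen {w : A | ‖Q ^ k - w‖ < m ^ k} :=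
    isOpen_lt (by fun_prop) continuous_const
  obtain ⟨w, hw, hwI⟩ := mem_closure_iff.1 hyI' _ ho (by simpa using hlt)
  obtain ⟨b, rfl⟩ := Ideal.mem_span_singleton'.1 hwI
  exact ⟨b, hw⟩

lemma exists_norm_mul_sub_one_lt_of_denseRange {P : Type*} [CommRing P] [Algebra ℂ P]
    (ι : P →ₐ[ℂ] A) (hι : DenseRange ι) (p : P) (h : ∀ χ : A →ₐ[ℂ] ℂ, χ (ι p) ≠ 0) {ε : ℝ}
    (hε : 0 < ε) : ∃ q : P, ‖ι (p * q - 1)‖ < ε := by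
  obtain ⟨b, hb⟩ := (isUnit_of_forall_algHom_ne_zero h).exists_right_inv
  have ho : IsOpen {b : A | ‖ι p * b - 1‖ < ε} := isOpen_lt (by fun_prop) continuous_const
  obtain ⟨q, hq⟩ := hι.exists_mem_open ho ⟨b, by simp [hb, hε]⟩
  refine ⟨q, ?_⟩
  rw [map_sub, map_mul, map_one]
  exact hq

lemma exists_norm_pow_sub_mul_lt_of_denseRange {P : Type*} [CommRing P] [Algebra ℂ P]
    (ι : P →ₐ[ℂ] A) (hι : DenseRange ι) (p q : P) {m : ℝ} (hm : 0 < m)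
    (h : ∀ χ : A →ₐ[ℂ] ℂ, χ (ι p) = 0 → ‖χ (ι q)‖ < m) :
    ∃ k : ℕ, 0 < k ∧ ∃ b : P, ‖ι (q ^ k - p * b)‖ < m ^ k := by
  obtain ⟨k, hk, b, hb⟩ := exists_norm_pow_sub_mul_lt (ι p) (ι q) hm h
  have ho : IsOpen {b : A | ‖ι q ^ k - b * ι p‖ < m ^ k} :=
    isOpen_lt (by fun_prop) continuous_const
  obtain ⟨b', hb'⟩ := hι.exists_mem_open ho ⟨b, hb⟩
  refine ⟨k, hk, b', ?_⟩
  rw [map_sub, map_mul, map_pow, mul_comm]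
  exact hb'

end BanachAlgebra

lemma exists_approx_inverse {n : ℕ} {K : Set (Fin n → ℂ)} (hK : IsCompact K)
    {p : MvPolynomial (Fin n) ℂ} (hp : ∀ z ∈ polyHull n K, MvPolynomial.eval z p ≠ 0)
    {ε : ℝ} (hε : 0 < ε) :
    ∃ q : MvPolynomial (Fin n) ℂ, ∀ z ∈ polyHull n K,
      ‖MvPolynomial.eval z p * MvPolynomial.eval z q - 1‖ < ε := by
  have := isCompact_iff_compactSpace.1 hK
  obtain ⟨q, hq⟩ := exists_norm_mul_sub_one_lt_of_denseRange (polyIncl K) (denseRange_polyIncl K) p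
    (fun χ hχ => by
      obtain ⟨x, hx, hxp⟩ := exists_mem_polyHull_of_algHom χ
      exact hp x hx ((hxp p).symm.trans hχ)) hε
  refine ⟨q, fun z hz => ?_⟩
  have := norm_eval_le_norm_polyIncl (p * q - 1) hz
  simp only [MvPolynomial.eval_sub, MvPolynomial.eval_mul, map_one] at this
  exact this.trans_lt hq

/-- The topological boundary of the image of a hull under a polynomial lies in the image of the
generating set. -/
lemma frontier_image_polyHull_subset {n : ℕ} {K : Set (Fin n → ℂ)} (hK : IsCompact K)
    (p : MvPolynomial (Fin n) ℂ) :
    frontier ((fun z => MvPolynomial.eval z p) '' polyHull n K) ⊆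
      (fun z => MvPolynomial.eval z p) '' K := by
  intro c hc
  by_contra hcK
  have hcl : IsClosed ((fun z => MvPolynomial.eval z p) '' K) :=
    (hK.image (MvPolynomial.continuous_eval p)).isClosed
  have hclX : IsClosed ((fun z => MvPolynomial.eval z p) '' polyHull n K) :=
    (isCompact_polyHull.image (MvPolynomial.continuous_eval p)).isClosed
  obtain ⟨d, hd, hdK⟩ := Metric.isOpen_iff.1 hcl.isOpen_compl c hcK
  rw [frontier_eq_closure_inter_closure, hclX.closure_eq] at hc
  obtain ⟨⟨x, hx, hxc⟩, hc2⟩ := hc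
  obtain ⟨c', hc', hcc'⟩ := Metric.mem_closure_iff.1 hc2 (d / 4) (by positivity)
  obtain ⟨q, hq⟩ := exists_approx_inverse hK (p := p - MvPolynomial.C c')
    (fun z hz h0 => hc' ⟨z, hz, by simpa [sub_eq_zero] using h0⟩) (ε := 1 / 4) (by norm_num)
  simp only [map_sub, MvPolynomial.eval_C] at hq
  have hbound : ‖MvPolynomial.eval x q‖ ≤ 5 / (3 * d) := by
    refine (mem_polyHull_iff hK).1 hx q _ fun w hw => ?_
    have h1 := hq w (subset_polyHull hK hw)
    have h2 : d ≤ ‖MvPolynomial.eval w p - c‖ := by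
      by_contra! hlt
      exact hdK (mem_ball_iff_norm.2 hlt) ⟨w, hw, rfl⟩
    have h3 : 3 * d / 4 ≤ ‖MvPolynomial.eval w p - c'‖ := by
      rw [dist_eq_norm] at hcc'
      have h4 : ‖MvPolynomial.eval w p - c‖ ≤ ‖MvPolynomial.eval w p - c'‖ + ‖c - c'‖ := by
        have : MvPolynomial.eval w p - c = (MvPolynomial.eval w p - c') - (c - c') := by ring
        rw [this]; exact norm_sub_le _ _
      linarith
    have h5 : ‖MvPolynomial.eval w p - c'‖ * ‖MvPolynomial.eval w q‖ ≤ 5 / 4 := by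
      rw [← norm_mul]
      have := norm_sub_norm_le ((MvPolynomial.eval w p - c') * MvPolynomial.eval w q) 1
      simp only [norm_one] at this
      linarith
    have h6 : 3 * d / 4 * ‖MvPolynomial.eval w q‖ ≤ 5 / 4 :=
      (mul_le_mul_of_nonneg_right h3 (norm_nonneg _)).trans h5
    rw [le_div_iff₀ (by positivity)]
    linarith
  have h1 := hq x hx
  have h2 : ‖MvPolynomial.eval x p - c'‖ < d / 4 := by
    have : MvPolynomial.eval x p = c := hxc
    rw [this, ← dist_eq_norm]; exact hcc'
  have h3 : 3 / 4 ≤ ‖MvPolynomial.eval x p - c'‖ * ‖MvPolynomial.eval x q‖ := by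
    rw [← norm_mul]
    have := norm_sub_norm_le 1 ((MvPolynomial.eval x p - c') * MvPolynomial.eval x q)
    rw [norm_sub_rev] at h1
    simp only [norm_one] at this
    linarith
  have h4 : ‖MvPolynomial.eval x p - c'‖ * ‖MvPolynomial.eval x q‖ ≤ d / 4 * (5 / (3 * d)) := by
    gcongr
  have h5 : d / 4 * (5 / (3 * d)) = 5 / 12 := by field_simp; norm_num
  linarith

lemma exists_pow_approx_multiple {n : ℕ} {K : Set (Fin n → ℂ)} (hK : IsCompact K)
    (p q : MvPolynomial (Fin n) ℂ) (c : ℂ) {m : ℝ} (hm : 0 < m)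
    (h : ∀ z ∈ polyHull n K, MvPolynomial.eval z p = c → ‖MvPolynomial.eval z q‖ < m) :
    ∃ k : ℕ, 0 < k ∧ ∃ b : MvPolynomial (Fin n) ℂ, ∀ z ∈ polyHull n K,
      ‖MvPolynomial.eval z q ^ k - (MvPolynomial.eval z p - c) * MvPolynomial.eval z b‖ < m ^ k := by
  have := isCompact_iff_compactSpace.1 hK
  obtain ⟨k, hk, b, hb⟩ := exists_norm_pow_sub_mul_lt_of_denseRange (polyIncl K)
    (denseRange_polyIncl K) (p - MvPolynomial.C c) q hm (fun χ hχ => by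
      obtain ⟨x, hx, hxp⟩ := exists_mem_polyHull_of_algHom χ
      rw [hxp] at hχ ⊢
      exact h x hx (by simpa [sub_eq_zero] using hχ))
  refine ⟨k, hk, b, fun z hz => ?_⟩
  have := norm_eval_le_norm_polyIncl (q ^ k - (p - MvPolynomial.C c) * b) hz
  simp only [MvPolynomial.eval_sub, MvPolynomial.eval_mul, MvPolynomial.eval_pow,
    MvPolynomial.eval_C] at this
  exact this.trans_lt hb

lemma IsPrimitiveRoot.sum_div_sub {N : ℕ} {ω : ℂ} (hω : IsPrimitiveRoot ω N) (hN : 0 < N) (r w : ℂ)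
    (hw : w ^ N ≠ r ^ N) :
    ∑ j ∈ Finset.range N, r * ω ^ j / (w - r * ω ^ j) = N * r ^ N / (w ^ N - r ^ N) := by
  have hpow (j : ℕ) : (r * ω ^ j) ^ N = r ^ N := by
    rw [mul_pow, ← pow_mul, mul_comm j N, pow_mul, hω.pow_eq_one, one_pow, mul_one]
  have hne (j : ℕ) : w - r * ω ^ j ≠ 0 := by
    intro h0
    apply hw
    rw [← hpow j, ← sub_eq_zero.1 h0]
  have hne' : w ^ N - r ^ N ≠ 0 := sub_ne_zero.2 hw
  rw [eq_div_iff hne', Finset.sum_mul]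
  have hterm (j : ℕ) : r * ω ^ j / (w - r * ω ^ j) * (w ^ N - r ^ N) =
      ∑ i ∈ Finset.range N, w ^ i * (r ^ (N - i) * (ω ^ (N - i)) ^ j) := by
    have h1 : (∑ i ∈ Finset.range N, w ^ i * (r * ω ^ j) ^ (N - 1 - i)) * (w - r * ω ^ j) =
        w ^ N - r ^ N := by rw [(Commute.all _ _).geom_sum₂_mul, hpow]
    rw [← h1, div_mul_eq_mul_div, div_eq_iff (hne j), ← mul_assoc]
    congr 1
    rw [Finset.mul_sum]
    refine Finset.sum_congr rfl fun i hi => ?_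
    have h2 : N - i = N - 1 - i + 1 := by have := Finset.mem_range.1 hi; omega
    rw [h2, ← pow_mul, mul_comm (_ + 1) j, pow_mul, ← mul_pow, pow_succ (r * ω ^ j)]
    ring
  simp only [hterm]
  rw [Finset.sum_comm, Finset.sum_eq_single 0]
  · simp [hω.pow_eq_one]
  · intro i hi hi0
    rw [← Finset.mul_sum, ← Finset.mul_sum]
    have hiN := Finset.mem_range.1 hi
    have h3 : ω ^ (N - i) ≠ 1 := hω.pow_ne_one_of_pos_of_lt (by omega) (by omega)
    have h4 : ∑ j ∈ Finset.range N, (ω ^ (N - i)) ^ j = 0 := by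
      have := mul_neg_geom_sum (ω ^ (N - i)) N
      rw [← pow_mul, mul_comm (N - i) N, pow_mul, hω.pow_eq_one, one_pow, sub_self] at this
      exact (mul_eq_zero.1 this).resolve_left (sub_ne_zero.2 (Ne.symm h3))
    rw [h4, mul_zero, mul_zero]
  · intro h; exact absurd (Finset.mem_range.2 hN) h

lemma exists_common_pow_approx_multiple {n : ℕ} {K : Set (Fin n → ℂ)} (hK : IsCompact K)
    (p q : MvPolynomial (Fin n) ℂ) {m : ℝ} (hm : 0 < m) {S : Set ℂ} (hS : IsCompact S)
    (h : ∀ z ∈ polyHull n K, MvPolynomial.eval z p ∈ S → ‖MvPolynomial.eval z q‖ < m) :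
    ∃ k : ℕ, 0 < k ∧ ∀ c ∈ S, ∀ l : ℕ, 0 < l → ∃ b : MvPolynomial (Fin n) ℂ, ∀ z ∈ polyHull n K,
      ‖MvPolynomial.eval z q ^ (k * l) - (MvPolynomial.eval z p - c) * MvPolynomial.eval z b‖
        < m ^ (k * l) := by
  have hpow {k l : ℕ} (hl : 0 < l) {c : ℂ} {b : MvPolynomial (Fin n) ℂ} (hb : ∀ z ∈ polyHull n K,
      ‖MvPolynomial.eval z q ^ k - (MvPolynomial.eval z p - c) * MvPolynomial.eval z b‖ < m ^ k) :
      ∃ b : MvPolynomial (Fin n) ℂ, ∀ z ∈ polyHull n K,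
        ‖MvPolynomial.eval z q ^ (k * l) - (MvPolynomial.eval z p - c) * MvPolynomial.eval z b‖
          < m ^ (k * l) := by
    obtain ⟨d, hd⟩ := sub_dvd_pow_sub_pow (q ^ k) (q ^ k - (p - MvPolynomial.C c) * b) l
    refine ⟨b * d, fun z hz => ?_⟩
    have h1 := congrArg (MvPolynomial.eval z) hd
    simp only [MvPolynomial.eval_sub, MvPolynomial.eval_mul, MvPolynomial.eval_pow,
      MvPolynomial.eval_C, sub_sub_cancel] at h1
    have h2 : MvPolynomial.eval z q ^ (k * l) -
        (MvPolynomial.eval z p - c) * MvPolynomial.eval z (b * d) =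
        (MvPolynomial.eval z q ^ k - (MvPolynomial.eval z p - c) * MvPolynomial.eval z b) ^ l := by
      rw [MvPolynomial.eval_mul, pow_mul, ← mul_assoc, ← h1]; ring
    rw [h2, norm_pow, pow_mul]
    exact pow_lt_pow_left₀ (hb z hz) (norm_nonneg _) hl.ne'
  suffices H : ∃ k : ℕ, 0 < k ∧ ∀ c ∈ S, ∃ b : MvPolynomial (Fin n) ℂ, ∀ z ∈ polyHull n K,
      ‖MvPolynomial.eval z q ^ k - (MvPolynomial.eval z p - c) * MvPolynomial.eval z b‖
        < m ^ k by
    obtain ⟨k, hk, H⟩ := H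
    refine ⟨k, hk, fun c hc l hl => ?_⟩
    obtain ⟨b, hb⟩ := H c hc
    exact hpow hl hb
  refine hS.induction_on (p := fun S => ∃ k : ℕ, 0 < k ∧ ∀ c ∈ S, ∃ b : MvPolynomial (Fin n) ℂ,
      ∀ z ∈ polyHull n K,
      ‖MvPolynomial.eval z q ^ k - (MvPolynomial.eval z p - c) * MvPolynomial.eval z b‖
        < m ^ k) ⟨1, one_pos, by simp⟩ ?_ ?_ ?_
  · rintro s t hst ⟨k, hk, H⟩
    exact ⟨k, hk, fun c hc => H c (hst hc)⟩
  · rintro s t ⟨k, hk, H⟩ ⟨k', hk', H'⟩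
    refine ⟨k * k', by positivity, fun c hc => ?_⟩
    rcases hc with hc | hc
    · obtain ⟨b, hb⟩ := H c hc
      exact hpow hk' hb
    · obtain ⟨b, hb⟩ := H' c hc
      rw [mul_comm]
      exact hpow hk hb
  · intro c hc
    obtain ⟨k, hk, b, hb⟩ := exists_pow_approx_multiple hK p q c hm
      (fun z hz hzc => h z hz (hzc ▸ hc))
    have hcont : Continuous fun a : ℂ × (Fin n → ℂ) =>
        ‖MvPolynomial.eval a.2 q ^ k - (MvPolynomial.eval a.2 p - a.1) * MvPolynomial.eval a.2 b‖ := by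
      have := MvPolynomial.continuous_eval q
      have := MvPolynomial.continuous_eval p
      have := MvPolynomial.continuous_eval b
      fun_prop
    have ho : IsOpen {a : ℂ × (Fin n → ℂ) |
        ‖MvPolynomial.eval a.2 q ^ k - (MvPolynomial.eval a.2 p - a.1) * MvPolynomial.eval a.2 b‖
          < m ^ k} := isOpen_lt hcont continuous_const
    have : ∀ᶠ a in 𝓝 c, ∀ z ∈ polyHull n K, ‖MvPolynomial.eval z q ^ k -
        (MvPolynomial.eval z p - a) * MvPolynomial.eval z b‖ < m ^ k :=
      (isCompact_polyHull (n := n) (K := K)).eventually_forall_of_forall_eventually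
        fun z hz => ho.mem_nhds (hb z hz)
    exact ⟨_, mem_nhdsWithin_of_mem_nhds this, k, hk, fun a ha => ⟨b, ha⟩⟩

/-- Averaging over the vertices of a regular polygon. -/
lemma norm_average_div_sub_sub_le {N : ℕ} {ω : ℂ} (hω : IsPrimitiveRoot ω N) (hN : 0 < N)
    {r : ℝ} (hr : 0 < r) {w a : ℂ} {s ε : ℝ} (hs : 0 < s) (hw : s ≤ |‖w‖ - r|) (hwN : w ^ N ≠ r ^ N)
    {b : ℕ → ℂ} (hb : ∀ j, ‖a - (w - r * ω ^ j) * b j‖ ≤ ε) :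
    ‖a * (r ^ N / (w ^ N - r ^ N)) - (N : ℂ)⁻¹ * ∑ j ∈ Finset.range N, r * ω ^ j * b j‖ ≤
      r * ε / s := by
  have hN' : (N : ℂ) ≠ 0 := by exact_mod_cast hN.ne'
  have hnorm (j : ℕ) : ‖(r : ℂ) * ω ^ j‖ = r := by
    rw [norm_mul, norm_pow, hω.norm'_eq_one hN.ne', one_pow, mul_one, Complex.norm_real,
      Real.norm_of_nonneg hr.le]
  have hsj (j : ℕ) : s ≤ ‖w - r * ω ^ j‖ := by
    refine hw.trans ((abs_norm_sub_norm_le _ _).trans' ?_)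
    rw [hnorm]
  have h1 := hω.sum_div_sub hN r w hwN
  have h2 : a * (r ^ N / (w ^ N - r ^ N)) - (N : ℂ)⁻¹ * ∑ j ∈ Finset.range N, r * ω ^ j * b j =
      (N : ℂ)⁻¹ * ∑ j ∈ Finset.range N,
        r * ω ^ j / (w - r * ω ^ j) * (a - (w - r * ω ^ j) * b j) := by
    have h3 : (r : ℂ) ^ N / (w ^ N - r ^ N) =
        (N : ℂ)⁻¹ * ∑ j ∈ Finset.range N, r * ω ^ j / (w - r * ω ^ j) := by
      rw [h1]; field_simp
    rw [h3, mul_left_comm, ← mul_sub, Finset.mul_sum, ← Finset.sum_sub_distrib]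
    congr 1
    refine Finset.sum_congr rfl fun j _ => ?_
    have : w - r * ω ^ j ≠ 0 := norm_pos_iff.1 (hs.trans_le (hsj j))
    field_simp
  rw [h2, norm_mul, norm_inv, Complex.norm_natCast, inv_mul_le_iff₀ (by exact_mod_cast hN)]
  refine (norm_sum_le_of_le (f := _) _ (n := fun _ => r * ε / s) fun j _ => ?_).trans ?_
  · rw [norm_mul, norm_div, hnorm, mul_comm r ε, mul_div_assoc, mul_comm]
    gcongr
    · exact (norm_nonneg _).trans (hb j)
    · exact hb j
    · exact hsj j
  · simp

lemma norm_pow_eval_le_of_approx {n : ℕ} {K : Set (Fin n → ℂ)} (hK : IsCompact K)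
    (p q : MvPolynomial (Fin n) ℂ) {c : ℂ} {r d d' ε : ℝ} (hr : 0 < r) (hd : 0 < d) (hd' : 0 < d')
    (hKr : ∀ w ∈ K, r + d ≤ ‖MvPolynomial.eval w p - c‖) {k : ℕ}
    (h : ∀ a : ℂ, ‖a - c‖ = r → ∃ b : MvPolynomial (Fin n) ℂ, ∀ z ∈ polyHull n K,
      ‖MvPolynomial.eval z q ^ k - (MvPolynomial.eval z p - a) * MvPolynomial.eval z b‖ ≤ ε)
    {x : Fin n → ℂ} (hx : x ∈ polyHull n K) (hxr : ‖MvPolynomial.eval x p - c‖ + d' ≤ r) :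
    ‖MvPolynomial.eval x q‖ ^ k ≤ 2 * (r * ε / d + r * ε / d') := by
  obtain ⟨B, hB⟩ : ∃ B : ℝ, ∀ w ∈ K, ‖MvPolynomial.eval w q ^ k‖ ≤ B := by
    obtain ⟨B, hB⟩ := (hK.image ((MvPolynomial.continuous_eval q).pow k)).isBounded.exists_norm_le
    exact ⟨B, fun w hw => hB _ ⟨w, hw, rfl⟩⟩
  let B' := max B 0
  have hB' : ∀ w ∈ K, ‖MvPolynomial.eval w q ^ k‖ ≤ B' := fun w hw => (hB w hw).trans (le_max_left _ _)
  have hB0 : 0 ≤ B' := le_max_right _ _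
  have main (N : ℕ) (hN : 0 < N) : ‖MvPolynomial.eval x q‖ ^ k ≤
      2 * (B' * (r ^ N / ((r + d) ^ N - r ^ N)) + r * ε / d + r * ε / d') := by
    let ω : ℂ := Complex.exp (2 * Real.pi * Complex.I / N)
    have hω : IsPrimitiveRoot ω N := Complex.isPrimitiveRoot_exp N hN.ne'
    have hnorm (j : ℕ) : ‖(r : ℂ) * ω ^ j‖ = r := by
      rw [norm_mul, norm_pow, hω.norm'_eq_one hN.ne', one_pow, mul_one, Complex.norm_real,
        Real.norm_of_nonneg hr.le]
    choose b hb using fun j : ℕ => h (c + r * ω ^ j) (by simpa using hnorm j)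
    let T : MvPolynomial (Fin n) ℂ :=
      MvPolynomial.C ((N : ℂ)⁻¹) * ∑ j ∈ Finset.range N, MvPolynomial.C (r * ω ^ j) * b j
    have hT (z) : MvPolynomial.eval z T =
        (N : ℂ)⁻¹ * ∑ j ∈ Finset.range N, r * ω ^ j * MvPolynomial.eval z (b j) := by
      simp only [T, MvPolynomial.eval_mul, MvPolynomial.eval_C, map_sum]
    have hb' (j : ℕ) (z) (hz : z ∈ polyHull n K) : ‖MvPolynomial.eval z q ^ k -
        (MvPolynomial.eval z p - c - r * ω ^ j) * MvPolynomial.eval z (b j)‖ ≤ ε := by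
      rw [sub_sub]; exact hb j z hz
    have hrN : ‖(r : ℂ) ^ N‖ = r ^ N := by
      rw [norm_pow, Complex.norm_real, Real.norm_of_nonneg hr.le]
    have hKT : ‖MvPolynomial.eval x T‖ ≤ B' * (r ^ N / ((r + d) ^ N - r ^ N)) + r * ε / d := by
      refine (mem_polyHull_iff hK).1 hx T _ fun w hw => ?_
      have h1 := hKr w hw
      have h2 : (r + d) ^ N - r ^ N ≤
          ‖(MvPolynomial.eval w p - c) ^ N - (r : ℂ) ^ N‖ := by
        refine (norm_sub_norm_le _ _).trans' ?_
        rw [hrN, norm_pow]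
        gcongr
      have h3 : 0 < (r + d) ^ N - r ^ N := sub_pos.2 (pow_lt_pow_left₀ (by linarith) hr.le hN.ne')
      have h4 := norm_average_div_sub_sub_le hω hN hr hd (w := MvPolynomial.eval w p - c)
        (a := MvPolynomial.eval w q ^ k) (ε := ε)
        (by rw [le_abs]; left; linarith)
        (sub_ne_zero.1 (norm_pos_iff.1 (h3.trans_le h2)))
        (fun j => hb' j w (subset_polyHull hK hw))
      rw [← hT] at h4
      have h5 : ‖MvPolynomial.eval w q ^ k *
          (r ^ N / ((MvPolynomial.eval w p - c) ^ N - r ^ N))‖ ≤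
          B' * (r ^ N / ((r + d) ^ N - r ^ N)) := by
        rw [norm_mul, norm_div, hrN]
        gcongr
        exact hB' w hw
      have h6 := norm_sub_norm_le (MvPolynomial.eval w T) (MvPolynomial.eval w q ^ k *
          (r ^ N / ((MvPolynomial.eval w p - c) ^ N - r ^ N)))
      rw [norm_sub_rev] at h6
      linarith
    have h1 : ‖MvPolynomial.eval x p - c‖ ^ N < r ^ N :=
      pow_lt_pow_left₀ (by linarith) (norm_nonneg _) hN.ne'
    have hne : (MvPolynomial.eval x p - c) ^ N ≠ (r : ℂ) ^ N := by
      intro h2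
      have := congrArg norm h2
      rw [hrN, norm_pow] at this
      exact h1.ne this
    have h4 := norm_average_div_sub_sub_le hω hN hr hd' (w := MvPolynomial.eval x p - c)
        (a := MvPolynomial.eval x q ^ k) (ε := ε)
        (by rw [le_abs]; right; linarith) hne (fun j => hb' j x hx)
    rw [← hT] at h4
    have h5 : ‖MvPolynomial.eval x q‖ ^ k * (1 / 2) ≤ ‖MvPolynomial.eval x q ^ k *
          (r ^ N / ((MvPolynomial.eval x p - c) ^ N - r ^ N))‖ := by
      rw [norm_mul, norm_pow, norm_div, hrN]
      refine mul_le_mul_of_nonneg_left ?_ (by positivity)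
      rw [div_le_div_iff₀ two_pos (norm_pos_iff.2 (sub_ne_zero.2 hne))]
      have := norm_sub_le ((MvPolynomial.eval x p - c) ^ N) ((r : ℂ) ^ N)
      rw [hrN, norm_pow] at this
      linarith
    have h6 := norm_sub_norm_le (MvPolynomial.eval x q ^ k *
          (r ^ N / ((MvPolynomial.eval x p - c) ^ N - r ^ N))) (MvPolynomial.eval x T)
    linarith
  have hlim : Tendsto (fun N : ℕ => 2 * (B' * (r ^ N / ((r + d) ^ N - r ^ N)) + r * ε / d
      + r * ε / d')) atTop (𝓝 (2 * (B' * 0 + r * ε / d + r * ε / d'))) := by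
    refine ((Tendsto.add_const _ (Tendsto.add_const _ (Tendsto.const_mul _ ?_)))).const_mul _
    have h1 : Tendsto (fun N : ℕ => ((r + d) / r) ^ N - 1) atTop atTop :=
      tendsto_atTop_add_const_right _ _
        (tendsto_pow_atTop_atTop_of_one_lt (by rw [lt_div_iff₀ hr]; linarith))
    refine (tendsto_inv_atTop_zero.comp h1).congr fun N => ?_
    have : r ^ N ≠ 0 := by positivity
    simp only [Function.comp, div_pow]
    rw [← div_self this, ← sub_div, inv_div]
  have := ge_of_tendsto hlim ((eventually_gt_atTop 0).mono fun N hN => main N hN)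
  simpa using this

/-- A local maximum principle for polynomial hulls. -/
lemma norm_eval_le_of_forall_sphere {n : ℕ} {K : Set (Fin n → ℂ)} (hK : IsCompact K)
    (p q : MvPolynomial (Fin n) ℂ) {c : ℂ} {r m : ℝ} (hr : 0 < r)
    (hKr : ∀ w ∈ K, r < ‖MvPolynomial.eval w p - c‖)
    (h : ∀ z ∈ polyHull n K, ‖MvPolynomial.eval z p - c‖ = r → ‖MvPolynomial.eval z q‖ ≤ m)
    {x : Fin n → ℂ} (hx : x ∈ polyHull n K) (hxr : ‖MvPolynomial.eval x p - c‖ ≤ r) :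
    ‖MvPolynomial.eval x q‖ ≤ m := by
  rcases hxr.eq_or_lt with hxr | hxr
  · exact h x hx hxr
  have main (q : MvPolynomial (Fin n) ℂ) {m : ℝ} (hm : 0 < m) (h : ∀ z ∈ polyHull n K,
      ‖MvPolynomial.eval z p - c‖ = r → ‖MvPolynomial.eval z q‖ < m) :
      ‖MvPolynomial.eval x q‖ ≤ m := by
    obtain ⟨d, hd, hKd⟩ : ∃ d > 0, ∀ w ∈ K, r + d ≤ ‖MvPolynomial.eval w p - c‖ := by
      rcases K.eq_empty_or_nonempty with rfl | hne
      · exact ⟨1, one_pos, by simp⟩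
      obtain ⟨w, hw, hmin⟩ := hK.exists_isMinOn hne
        (((MvPolynomial.continuous_eval p).sub continuous_const).norm.continuousOn
          (s := K) (f := fun w => ‖MvPolynomial.eval w p - c‖))
      exact ⟨_, sub_pos.2 (hKr w hw), fun w' hw' => by
        have := hmin hw'
        simp only [mem_ofPred_eq] at this
        linarith⟩
    obtain ⟨k, hk, H⟩ := exists_common_pow_approx_multiple hK p q hm (isCompact_sphere c r)
      (fun z hz hzS => h z hz (mem_sphere_iff_norm.1 hzS))
    have hd' : 0 < r - ‖MvPolynomial.eval x p - c‖ := sub_pos.2 hxr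
    have hl (l : ℕ) (hl : 0 < l) : (‖MvPolynomial.eval x q‖ ^ k / m ^ k) ^ l ≤
        2 * (r / d + r / (r - ‖MvPolynomial.eval x p - c‖)) := by
      have := norm_pow_eval_le_of_approx hK p q hr hd hd' hKd (k := k * l) (ε := m ^ (k * l))
        (fun a ha => by
          obtain ⟨b, hb⟩ := H a (mem_sphere_iff_norm.2 ha) l hl
          exact ⟨b, fun z hz => (hb z hz).le⟩) hx (by linarith)
      rw [div_pow, ← pow_mul, ← pow_mul, div_le_iff₀ (by positivity)]
      refine this.trans (le_of_eq ?_)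
      ring
    by_contra! hlt
    have h1 : 1 < ‖MvPolynomial.eval x q‖ ^ k / m ^ k := by
      rw [one_lt_div (by positivity)]
      exact pow_lt_pow_left₀ hlt hm.le hk.ne'
    have h2 := tendsto_pow_atTop_atTop_of_one_lt h1
    obtain ⟨l, hl1, hl2⟩ := ((h2.eventually_gt_atTop
      (2 * (r / d + r / (r - ‖MvPolynomial.eval x p - c‖)))).and (eventually_gt_atTop 0)).exists
    exact (hl l hl2).not_gt hl1
  by_cases hE : ∃ z ∈ polyHull n K, ‖MvPolynomial.eval z p - c‖ = r
  · obtain ⟨z, hz, hzr⟩ := hE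
    have hm : 0 ≤ m := (norm_nonneg _).trans (h z hz hzr)
    refine le_of_forall_pos_le_add fun δ hδ => ?_
    exact main q (by linarith) fun z hz hzr => by have := h z hz hzr; linarith
  · push Not at hE
    have := main 1 (m := 1 / 2) (by norm_num) fun z hz hzr => absurd hzr (hE z hz)
    norm_num at this

/-- Rossi-type localisation: a saturated piece of a hull is the hull of its boundary. -/
lemma polyHull_inter_subset {n : ℕ} {K : Set (Fin n → ℂ)} (hK : IsCompact K)
    (p : MvPolynomial (Fin n) ℂ) {c : ℂ} {r : ℝ} (hr : 0 < r)
    (hKr : ∀ w ∈ K, r < ‖MvPolynomial.eval w p - c‖) :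
    polyHull n K ∩ {z | ‖MvPolynomial.eval z p - c‖ ≤ r} ⊆
      polyHull n (polyHull n K ∩ {z | ‖MvPolynomial.eval z p - c‖ = r}) := by
  rintro x ⟨hx, hxr⟩
  have hcomp : IsCompact (polyHull n K ∩ {z | ‖MvPolynomial.eval z p - c‖ = r}) :=
    isCompact_polyHull.inter_right (isClosed_eq
      ((MvPolynomial.continuous_eval p).sub continuous_const).norm continuous_const)
  exact (mem_polyHull_iff hcomp).2 fun q C hC =>
    norm_eval_le_of_forall_sphere hK p q hr hKr (fun z hz hzr => hC z ⟨hz, hzr⟩) hx hxr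

lemma contDiffOn_one_of_differentiableOn_complex {E : Type*} [NormedAddCommGroup E]
    [NormedSpace ℂ E] [ProperSpace E] {f : E → ℂ} {s : Set E} (hf : DifferentiableOn ℂ f s)
    (hs : IsOpen s) : ContDiffOn ℂ 1 f s := by
  rw [show (1 : WithTop ℕ∞) = 0 + 1 from rfl, contDiffOn_succ_iff_fderiv_of_isOpen hs]
  refine ⟨hf, by simp, ?_⟩
  rw [contDiffOn_zero]
  intro z0 hz0
  apply ContinuousAt.continuousWithinAt
  rw [Metric.continuousAt_iff]
  intro ε hε
  obtain ⟨R, hR, hRs⟩ := Metric.nhds_basis_closedBall.mem_iff.1 (hs.mem_nhds hz0)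
  have huc := (isCompact_closedBall z0 R).uniformContinuousOn_of_continuous
    (hf.continuousOn.mono hRs)
  rw [Metric.uniformContinuousOn_iff_le] at huc
  obtain ⟨δ, hδ, H⟩ := huc (ε / 2 * (R / 2)) (by positivity)
  refine ⟨min δ (R / 2), by positivity, fun z hz => ?_⟩
  have hzδ : dist z z0 ≤ δ := hz.le.trans (min_le_left _ _)
  have hzR : dist z z0 ≤ R / 2 := hz.le.trans (min_le_right _ _)
  rw [dist_eq_norm]
  refine lt_of_le_of_lt ?_ (half_lt_self hε)
  refine ContinuousLinearMap.opNorm_le_of_unit_norm (𝕜 := ℂ) (by positivity) fun v hv => ?_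
  have hmem (y : E) (hy : dist y z0 ≤ R / 2) (ζ : ℂ) (hζ : ‖ζ‖ ≤ R / 2) :
      y + ζ • v ∈ Metric.closedBall z0 R := by
    rw [mem_closedBall_iff_norm]
    rw [dist_eq_norm] at hy
    calc ‖y + ζ • v - z0‖ = ‖(y - z0) + ζ • v‖ := by congr 1; abel
      _ ≤ ‖y - z0‖ + ‖ζ • v‖ := norm_add_le _ _
      _ ≤ R / 2 + R / 2 := by rw [norm_smul, hv, mul_one]; gcongr
      _ = R := by ring
  have hder (y : E) (hy : dist y z0 ≤ R / 2) (ζ : ℂ) (hζ : ‖ζ‖ ≤ R / 2) :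
      HasDerivAt (fun ζ : ℂ => f (y + ζ • v)) (fderiv ℂ f (y + ζ • v) v) ζ := by
    have h1 := (hf.differentiableAt (hs.mem_nhds (hRs (hmem y hy ζ hζ)))).hasFDerivAt
    have h2 : HasDerivAt (fun ζ : ℂ => y + ζ • v) v ζ := by
      simpa using ((hasDerivAt_id ζ).smul_const v).const_add y
    exact h1.comp_hasDerivAt ζ h2
  have h00 : dist z0 z0 ≤ R / 2 := by simp; positivity
  have hd : HasDerivAt (fun ζ : ℂ => f (z + ζ • v) - f (z0 + ζ • v))
      (fderiv ℂ f z v - fderiv ℂ f z0 v) 0 := by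
    have h1 := hder z hzR 0 (by simp; positivity)
    have h2 := hder z0 h00 0 (by simp; positivity)
    simp only [zero_smul, add_zero] at h1 h2
    exact h1.sub h2
  have hle := Complex.norm_deriv_le_of_forall_mem_sphere_norm_le (c := (0 : ℂ)) (R := R / 2)
    (C := ε / 2 * (R / 2)) (f := fun ζ : ℂ => f (z + ζ • v) - f (z0 + ζ • v)) (by positivity)
    (by
      refine DifferentiableOn.diffContOnCl ?_
      rw [closure_ball _ (by positivity)]
      intro ζ hζ
      have hζ' : ‖ζ‖ ≤ R / 2 := by simpa using hζ
      exact ((hder z hzR ζ hζ').sub (hder z0 h00 ζ hζ')).differentiableAt.differentiableWithinAt)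
    (fun ζ hζ => by
      have hζ' : ‖ζ‖ ≤ R / 2 := by simpa using (mem_sphere_zero_iff_norm.1 hζ).le
      rw [← dist_eq_norm]
      refine H _ (hmem z hzR ζ hζ') _ (hmem z0 h00 ζ hζ') ?_
      rwa [dist_add_right])
  rw [hd.deriv, mul_div_cancel_right₀ _ (by positivity)] at hle
  rw [sub_apply]
  exact hle

/-- The null set of bad perturbations: `u + ηv` has no zero on a level set of a submersion for
almost every `η`. -/
lemma exists_add_mul_ne_zero_on_levelSet {Q : Set (ℝ × ℝ)} {g : ℝ × ℝ → ℝ} {t : ℝ}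
    {u v : ℝ × ℝ → ℂ}
    (hg : ∀ y ∈ Q, DifferentiableAt ℝ g y) (hdg : ∀ y ∈ Q, fderiv ℝ g y ≠ 0)
    (hu : ∀ y ∈ Q, DifferentiableAt ℝ u y) (hv : ∀ y ∈ Q, DifferentiableAt ℝ v y)
    (huv : ∀ y ∈ Q, g y = t → u y = 0 → v y ≠ 0) {ε : ℝ} (hε : 0 < ε) :
    ∃ η : ℂ, ‖η‖ < ε ∧ ∀ y ∈ Q, g y = t → u y + η * v y ≠ 0 := by
  let C : Set (ℝ × ℝ) := {y ∈ Q | g y = t ∧ v y ≠ 0}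
  let L := Complex.equivRealProdCLM
  let ψ : ℝ × ℝ → ℂ := fun y => -u y * (v y)⁻¹
  have hψ (y) (hy : y ∈ C) : DifferentiableAt ℝ ψ y :=
    (hu y hy.1).neg.mul (((differentiableAt_inv (𝕜 := ℂ) hy.2.2).restrictScalars ℝ).comp y
      (hv y hy.1))
  let ψ' : ℝ × ℝ → (ℝ × ℝ →L[ℝ] ℝ × ℝ) := fun y => (L : ℂ →L[ℝ] ℝ × ℝ).comp (fderiv ℝ ψ y)
  have hex (y : ℝ × ℝ) : ∃ d : ℝ × ℝ →L[ℝ] ℝ × ℝ, y ∈ C → d.det = 0 ∧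
      HasFDerivWithinAt (fun y => L (ψ y)) d C y := by
    by_cases hy : y ∈ C
    swap
    · exact ⟨0, fun h => absurd h hy⟩
    obtain ⟨w, hw⟩ : ∃ w, fderiv ℝ g y w ≠ 0 := by
      by_contra! h0
      exact hdg y hy.1 (ContinuousLinearMap.ext h0)
    let W := (fderiv ℝ g y w)⁻¹ • ψ' y w
    refine ⟨ψ' y - (fderiv ℝ g y).smulRight W, fun _ => ⟨?_, ?_⟩⟩
    · have hker : (ψ' y - (fderiv ℝ g y).smulRight W) w = 0 := by
        simp [W, smul_smul, hw]
      have hw0 : w ≠ 0 := by rintro rfl; simp at hw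
      by_contra hdet
      have : LinearMap.ker ((ψ' y - (fderiv ℝ g y).smulRight W : ℝ × ℝ →L[ℝ] ℝ × ℝ) :
          ℝ × ℝ →ₗ[ℝ] ℝ × ℝ) = ⊥ := by
        exact (LinearMap.isUnit_iff_ker_eq_bot _).1
          ((LinearMap.isUnit_iff_isUnit_det _).2 (isUnit_iff_ne_zero.2 hdet))
      exact hw0 ((Submodule.eq_bot_iff _).1 this w hker)
    · have h1 : HasFDerivWithinAt (fun y => L (ψ y)) (ψ' y) C y :=
        (L.hasFDerivAt.comp y (hψ y hy).hasFDerivAt).hasFDerivWithinAt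
      have h2 : HasFDerivWithinAt (fun y' => (g y' - t) • W)
          ((fderiv ℝ g y).smulRight W) C y :=
        (((hg y hy.1).hasFDerivAt.sub_const t).smul_const W).hasFDerivWithinAt
      refine (h1.sub h2).congr (fun y' hy' => ?_) ?_
      · simp [hy'.2.1]
      · simp [hy.2.1]
  choose d hd using hex
  have hnull : MeasureTheory.volume ((fun y => L (ψ y)) '' C) = 0 :=
    MeasureTheory.addHaar_image_eq_zero_of_det_fderivWithin_eq_zero _
      (fun y hy => (hd y hy).2) (fun y hy => (hd y hy).1)
  have hne : ∃ a ∈ L '' Metric.ball 0 ε, a ∉ (fun y => L (ψ y)) '' C := by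
    by_contra! hsub
    have ho : IsOpen (L '' Metric.ball 0 ε) := L.toHomeomorph.isOpenMap _ Metric.isOpen_ball
    have hpos := ho.measure_pos MeasureTheory.volume
      ((Metric.nonempty_ball.2 hε).image L)
    exact hpos.ne' (MeasureTheory.measure_mono_null hsub hnull)
  obtain ⟨_, ⟨η, hη, rfl⟩, hηC⟩ := hne
  refine ⟨η, mem_ball_zero_iff.1 hη, fun y hy hyt h0 => ?_⟩
  by_cases hv0 : v y = 0
  · rw [hv0, mul_zero, add_zero] at h0
    exact huv y hy hyt h0 hv0
  · refine hηC ⟨y, ⟨hy, hyt, hv0⟩, ?_⟩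
    have : ψ y = η := by
      simp only [ψ]
      rw [← div_eq_mul_inv, div_eq_iff hv0]
      linear_combination -h0
    simp only [this]

lemma isPreconnected_compl_closedBall {E : Type*} [NormedAddCommGroup E] [NormedSpace ℝ E]
    (h : 1 < Module.rank ℝ E) : IsPreconnected (Metric.closedBall (0 : E) 1)ᶜ := by
  have h1 := (isConnected_compl_singleton_of_one_lt_rank h (0 : E)).isPreconnected
  have h2 : (Metric.closedBall (0 : E) 1)ᶜ = (fun x : E => (1 + ‖x‖⁻¹) • x) '' {0}ᶜ := by
    ext y
    constructor
    · intro hy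
      have hy1 : 1 < ‖y‖ := by simpa using hy
      have hpos : 0 < 1 - ‖y‖⁻¹ := sub_pos.2 (inv_lt_one_of_one_lt₀ hy1)
      have hy0 : y ≠ 0 := by rintro rfl; simp at hy1; linarith
      refine ⟨(1 - ‖y‖⁻¹) • y, by simp [hpos.ne', hy0], ?_⟩
      simp only [smul_smul, norm_smul, Real.norm_of_nonneg hpos.le]
      have : (1 + ((1 - ‖y‖⁻¹) * ‖y‖)⁻¹) * (1 - ‖y‖⁻¹) = 1 := by
        have h3 : ‖y‖ ≠ 0 := by positivity
        have h4 : ‖y‖ - 1 ≠ 0 := by linarith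
        have h5 : (1 - ‖y‖⁻¹) * ‖y‖ = ‖y‖ - 1 := by field_simp
        rw [h5]
        field_simp
        ring
      rw [this, one_smul]
    · rintro ⟨x, hx, rfl⟩
      have hx0 : 0 < ‖x‖ := norm_pos_iff.2 hx
      simp only [mem_compl_iff, mem_closedBall_zero_iff, not_le, norm_smul]
      rw [Real.norm_of_nonneg (by positivity), add_mul, inv_mul_cancel₀ hx0.ne']
      linarith
  rw [h2]
  refine h1.image _ (ContinuousOn.smul ?_ continuousOn_id)
  exact continuousOn_const.add (continuous_norm.continuousOn.inv₀ fun x hx => norm_ne_zero_iff.2 hx)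

lemma frequently_lt_of_fderiv_ne_zero {E : Type*} [NormedAddCommGroup E] [NormedSpace ℝ E]
    {g : E → ℝ} {y : E} (hdg : fderiv ℝ g y ≠ 0) : ∃ᶠ x in 𝓝 y, g x < g y := by
  intro h
  exact hdg (IsLocalMin.fderiv_eq_zero (h.mono fun x hx => not_lt.1 hx))

lemma frequently_gt_of_fderiv_ne_zero {E : Type*} [NormedAddCommGroup E] [NormedSpace ℝ E]
    {g : E → ℝ} {y : E} (hdg : fderiv ℝ g y ≠ 0) : ∃ᶠ x in 𝓝 y, g y < g x := by
  intro h
  exact hdg (IsLocalMax.fderiv_eq_zero (h.mono fun x hx => not_lt.1 hx))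

/-- An open subset of the plane whose boundary lies in a level set contains a critical point. -/
lemma exists_fderiv_eq_zero_of_frontier_subset_levelSet {E : Type*} [NormedAddCommGroup E]
    [NormedSpace ℝ E] {g : E → ℝ} {B : Set E} {t : ℝ}
    (hB : IsOpen B) (hne : B.Nonempty) (hc : IsCompact (closure B))
    (hg : ContinuousOn g (closure B)) (ht : ∀ y ∈ closure B, y ∉ B → g y = t) :
    ∃ y ∈ B, fderiv ℝ g y = 0 := by
  obtain ⟨a, ha, hmax⟩ := hc.exists_isMaxOn hne.closure hg
  obtain ⟨b, hb, hmin⟩ := hc.exists_isMinOn hne.closure hg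
  by_cases haB : a ∈ B
  · exact ⟨a, haB, ((hmax.on_subset subset_closure).isLocalMax (hB.mem_nhds haB)).fderiv_eq_zero⟩
  by_cases hbB : b ∈ B
  · exact ⟨b, hbB, ((hmin.on_subset subset_closure).isLocalMin (hB.mem_nhds hbB)).fderiv_eq_zero⟩
  obtain ⟨y, hy⟩ := hne
  have hconst : ∀ x ∈ B, g x = t := fun x hx =>
    le_antisymm ((hmax (subset_closure hx)).trans_eq (ht a ha haB))
      ((ht b hb hbB).symm.trans_le (hmin (subset_closure hx)))
  refine ⟨y, hy, IsLocalMax.fderiv_eq_zero (mem_of_superset (hB.mem_nhds hy) fun x hx => ?_)⟩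
  exact (hconst x hx).trans_le (hconst y hy).ge

lemma eq_of_exp_eq_neg_one {a b : ℝ} (ha : Complex.exp (a * (Real.pi * Complex.I)) = -1)
    (hb : Complex.exp (b * (Real.pi * Complex.I)) = -1) (hab : |a - b| < 1) : a = b := by
  rw [← hb, Complex.exp_eq_exp_iff_exists_int] at ha
  obtain ⟨n, hn⟩ := ha
  have h1 : (a : ℂ) = b + 2 * n := by
    have hpi : (Real.pi * Complex.I : ℂ) ≠ 0 :=
      mul_ne_zero (by exact_mod_cast Real.pi_ne_zero) Complex.I_ne_zero
    apply mul_right_cancel₀ hpi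
    rw [hn]; ring
  have h2 : a = b + 2 * n := by exact_mod_cast h1
  rw [h2, add_sub_cancel_left, abs_lt] at hab
  have h3 : (n : ℝ) < 1 := by linarith
  have h4 : (-1 : ℝ) < n := by linarith
  have h5 : n < 1 := by exact_mod_cast h3
  have h6 : -1 < n := by exact_mod_cast h4
  have : n = 0 := by omega
  rw [h2, this]; simp

/-- A real-valued continuous function with values in the odd integers is locally constant. -/
lemma eventually_eq_of_exp_eq_neg_one {X : Type*} [TopologicalSpace X] {k : X → ℝ} {O : Set X}
    (hO : IsOpen O) (hk : ContinuousOn k O)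
    (h : ∀ y ∈ O, Complex.exp (k y * (Real.pi * Complex.I)) = -1) {y : X} (hy : y ∈ O) :
    ∀ᶠ x in 𝓝 y, x ∈ O ∧ k x = k y := by
  have h1 := (hk.continuousAt (hO.mem_nhds hy)).eventually
    (Metric.ball_mem_nhds (k y) one_pos)
  filter_upwards [h1, hO.mem_nhds hy] with x hx hxO
  exact ⟨hxO, eq_of_exp_eq_neg_one (h x hxO) (h y hy) (by rwa [← Real.dist_eq])⟩

lemma exists_continuous_angle {E : Type*} [NormedAddCommGroup E] [NormedSpace ℝ E]
    {Θ : E → ℂ} (hΘ : Continuous Θ) (h1 : ∀ y, ‖Θ y‖ = 1) :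
    ∃ θ : E → ℝ, Continuous θ ∧ ∀ y, Complex.exp (θ y * (Real.pi * Complex.I)) = Θ y := by
  have hsc : IsSimplyConnected (univ : Set E) := by
    have : ContractibleSpace (univ : Set E) := (convex_univ).contractibleSpace univ_nonempty
    exact inferInstanceAs (SimplyConnectedSpace (univ : Set E))
  obtain ⟨f, hf, hfe⟩ := Complex.exists_continuousOn_eqOn_exp_comp hsc isOpen_univ
    hΘ.continuousOn (by
      rintro ⟨y, -, hy⟩
      have := h1 y
      rw [hy, norm_zero] at this
      exact zero_ne_one this)
  rw [continuousOn_univ] at hf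
  refine ⟨fun y => (f y).im / Real.pi, by fun_prop, fun y => ?_⟩
  have h2 : Complex.exp (f y) = Θ y := hfe (mem_univ y)
  have h3 : (f y).re = 0 := by
    have := h1 y
    rw [← h2, Complex.norm_exp, Real.exp_eq_one_iff] at this
    exact this
  rw [← h2]
  congr 1
  apply Complex.ext
  · simp [h3]
  · have : Real.pi ≠ 0 := Real.pi_ne_zero
    simp [this]

lemma exp_pi_sign {s : ℝ} (hs : s = 1 ∨ s = -1) :
    Complex.exp (s * (Real.pi * Complex.I)) = -1 := by
  rcases hs with rfl | rfl
  · simp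
  · simp [Complex.exp_neg]

/-- A compact union of components of a level set inside a disc on which `g` has no critical point is
empty. -/
lemma eq_empty_of_relativelyOpen_levelSet {U : Set (ℝ × ℝ)} {g : ℝ × ℝ → ℝ} {t : ℝ}
    {C : Set (ℝ × ℝ)} (hU : IsOpen U) (hQU : Metric.closedBall 0 1 ⊆ U) (hg : ContinuousOn g U)
    (hdg : ∀ y ∈ Metric.closedBall (0 : ℝ × ℝ) 1, fderiv ℝ g y ≠ 0) (hC : IsCompact C)
    (hCQ : C ⊆ Metric.closedBall 0 1) (hCt : ∀ y ∈ C, g y = t)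
    (hrel : ∀ y ∈ C, ∀ᶠ x in 𝓝 y, g x = t → x ∈ C) : C = ∅ := by
  classical
  by_contra hne
  obtain ⟨y0, hy0⟩ := nonempty_iff_ne_empty.2 hne
  -- an isolating neighbourhood
  obtain ⟨W, hWo, hCW, hWcl, hWc⟩ := exists_open_between_and_isCompact_closure hC
    (isOpen_interior (s := {x | x ∈ U ∧ (g x = t → x ∈ C)})) (fun y hy =>
      mem_interior_iff_mem_nhds.2 ((hU.eventually_mem (hQU (hCQ hy))).and (hrel y hy)))
  have hWU : closure W ⊆ U := fun x hx => (interior_subset (hWcl hx)).1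
  have hWt : ∀ x ∈ closure W, g x = t → x ∈ C := fun x hx => (interior_subset (hWcl hx)).2
  have hgW : ContinuousOn g (closure W) := hg.mono hWU
  obtain ⟨ε, hε, hfr⟩ : ∃ ε > 0, ∀ x ∈ frontier W, ε ≤ |g x - t| := by
    have hfc : IsCompact (frontier W) := hWc.of_isClosed_subset isClosed_frontier
      frontier_subset_closure
    rcases (frontier W).eq_empty_or_nonempty with h0 | h0
    · exact ⟨1, one_pos, by simp [h0]⟩
    obtain ⟨x, hx, hmin⟩ := hfc.exists_isMinOn h0
      ((hgW.mono frontier_subset_closure).sub continuousOn_const).abs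
    refine ⟨_, abs_pos.2 (sub_ne_zero.2 fun h1 => ?_), fun x' hx' => hmin hx'⟩
    have : x ∈ W := hCW (hWt x (frontier_subset_closure hx) h1)
    rw [hWo.frontier_eq] at hx
    exact hx.2 this
  let c : ℝ → ℝ := fun s => max (-1) (min 1 (s / ε))
  have hc : Continuous c := by fun_prop
  have hc1 {s : ℝ} (hs : ε ≤ |s|) : c s = s / |s| := by
    rcases le_abs.1 hs with h | h
    · have hs0 : 0 < s := hε.trans_le h
      have : 1 ≤ s / ε := (one_le_div hε).2 h
      rw [abs_of_pos hs0, div_self hs0.ne']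
      simp [c, this]
    · have hs0 : s < 0 := by linarith
      have : s / ε ≤ -1 := by rw [div_le_iff₀ hε]; linarith
      rw [abs_of_neg hs0, div_neg, div_self hs0.ne]
      simp only [c]
      rw [min_eq_right (by linarith), max_eq_left this]
  have hsgn {s : ℝ} (hs : s ≠ 0) : s / |s| = 1 ∨ s / |s| = -1 := by
    rcases lt_or_gt_of_ne hs with h | h
    · right; rw [abs_of_neg h, div_neg, div_self hs]
    · left; rw [abs_of_pos h, div_self hs]
  -- the angular map
  let Θ : ℝ × ℝ → ℂ := fun y =>
    if y ∈ W then Complex.exp (c (g y - t) * (Real.pi * Complex.I)) else -1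
  have hfr0 {x} (hx : x ∈ frontier W) : g x - t ≠ 0 := fun h0 => by
    have := hfr x hx
    rw [h0, abs_zero] at this
    exact this.not_gt hε
  have hΘ : Continuous Θ := by
    refine continuous_if (fun y hy => ?_) ?_ continuousOn_const
    · rw [hc1 (hfr y hy)]
      exact exp_pi_sign (hsgn (hfr0 hy))
    · have : ContinuousOn (fun y => c (g y - t)) (closure W) :=
        hc.comp_continuousOn (hgW.sub continuousOn_const)
      exact Complex.continuous_exp.comp_continuousOn
        ((Complex.continuous_ofReal.comp_continuousOn this).mul continuousOn_const)
  have hΘ1 (y) : ‖Θ y‖ = 1 := by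
    by_cases hy : y ∈ W
    · simp only [Θ, hy, if_true]
      rw [← mul_assoc, ← Complex.ofReal_mul, Complex.norm_exp_ofReal_mul_I]
    · simp [Θ, hy]
  obtain ⟨θ, hθ, hθe⟩ := exists_continuous_angle hΘ hΘ1
  let j : ℝ → ℝ := fun s => c s - s / |s|
  have hj {s : ℝ} (hs : s ≠ 0) : ContinuousAt j s :=
    hc.continuousAt.sub (continuousAt_id.div continuous_abs.continuousAt (abs_ne_zero.2 hs))
  let κ : ℝ × ℝ → ℝ := fun y => if y ∈ W then j (g y - t) else 0
  let k : ℝ × ℝ → ℝ := fun y => θ y - κ y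
  have hne0 {y} (hy : y ∈ closure W) (hyC : y ∉ C) : g y - t ≠ 0 := fun h0 =>
    hyC (hWt y hy (sub_eq_zero.1 h0))
  have hκ : ContinuousOn κ Cᶜ := by
    refine ContinuousOn.if (fun y hy => ?_) ?_ continuousOn_const
    · simp only [j, hc1 (hfr y hy.2), sub_self]
    · intro y hy
      exact ContinuousAt.comp_continuousWithinAt (f := fun y => g y - t) (hj (hne0 hy.2 hy.1))
        ((hgW.mono inter_subset_right y hy).sub continuousWithinAt_const)
  have hk : ContinuousOn k Cᶜ := hθ.continuousOn.sub hκ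
  have hCo : IsOpen Cᶜ := hC.isClosed.isOpen_compl
  have hke : ∀ y ∈ Cᶜ, Complex.exp (k y * (Real.pi * Complex.I)) = -1 := by
    intro y hy
    by_cases hyW : y ∈ W
    · have h1 := hθe y
      simp only [Θ, hyW, if_true] at h1
      have h2 := exp_pi_sign (hsgn (hne0 (subset_closure hyW) hy))
      simp only [k, κ, j, hyW, if_true]
      rw [show (((θ y - (c (g y - t) - (g y - t) / |g y - t|) : ℝ) : ℂ) * (Real.pi * Complex.I)) =
        θ y * (Real.pi * Complex.I) - c (g y - t) * (Real.pi * Complex.I) +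
          ((g y - t) / |g y - t| : ℝ) * (Real.pi * Complex.I) by push_cast; ring,
        Complex.exp_add, Complex.exp_sub, h1, h2, div_self (Complex.exp_ne_zero _), one_mul]
    · have h1 := hθe y
      simp only [Θ, hyW, if_false] at h1
      simp only [k, κ, hyW, if_false, sub_zero, h1]
  have hloc {y} (hy : y ∈ Cᶜ) := eventually_eq_of_exp_eq_neg_one hCo hk hke hy
  -- the exterior value
  obtain ⟨m, hm⟩ : ∃ m, ∀ y ∈ (Metric.closedBall (0 : ℝ × ℝ) 1)ᶜ, k y = m := by
    have hpre : IsPreconnected (Metric.closedBall (0 : ℝ × ℝ) 1)ᶜ :=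
      isPreconnected_compl_closedBall (by simp [one_add_one_eq_two])
    have hQC : (Metric.closedBall (0 : ℝ × ℝ) 1)ᶜ ⊆ Cᶜ := compl_subset_compl.2 hCQ
    rcases ((Metric.closedBall (0 : ℝ × ℝ) 1)ᶜ).eq_empty_or_nonempty with h0 | ⟨b, hb⟩
    · exact ⟨0, by simp [h0]⟩
    refine ⟨k b, fun y hy => ?_⟩
    by_contra hyb
    obtain ⟨x, -, hx1, hx2⟩ := hpre {x | x ∈ Cᶜ ∧ k x = k b} {x | x ∈ Cᶜ ∧ k x ≠ k b}
      (isOpen_iff_mem_nhds.2 fun x hx => by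
        filter_upwards [hloc hx.1] with x' hx'
        exact ⟨hx'.1, hx'.2.trans hx.2⟩)
      (isOpen_iff_mem_nhds.2 fun x hx => by
        filter_upwards [hloc hx.1] with x' hx'
        exact ⟨hx'.1, hx'.2.trans_ne hx.2⟩)
      (fun x hx => by
        by_cases h : k x = k b
        · exact Or.inl ⟨hQC hx, h⟩
        · exact Or.inr ⟨hQC hx, h⟩)
      ⟨b, hb, hQC hb, rfl⟩ ⟨y, hy, hQC hy, hyb⟩
    exact hx2.2 hx1.2
  let B : Set (ℝ × ℝ) := {y | y ∈ Cᶜ ∧ k y ≠ m}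
  have hBo : IsOpen B := isOpen_iff_mem_nhds.2 fun x hx => by
    filter_upwards [hloc hx.1] with x' hx'
    exact ⟨hx'.1, hx'.2.trans_ne hx.2⟩
  have hBQ : B ⊆ Metric.closedBall 0 1 := fun y hy => by
    by_contra h
    exact hy.2 (hm y h)
  have hBQ' : closure B ⊆ Metric.closedBall 0 1 := closure_minimal hBQ Metric.isClosed_closedBall
  have hBC : ∀ y ∈ closure B, y ∉ B → g y = t := by
    intro y hy hyB
    by_contra hyt
    have hyC : y ∈ Cᶜ := fun h => hyt (hCt y h)
    obtain ⟨x, hx1, hx2⟩ := ((mem_closure_iff_frequently.1 hy).and_eventually (hloc hyC)).exists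
    exact hyB ⟨hyC, fun h => hx1.2 (hx2.2.trans h)⟩
  have hBne : B.Nonempty := by
    have hy0W := hCW hy0
    have hgc : ContinuousAt g y0 := hgW.continuousAt (mem_of_superset (hWo.mem_nhds hy0W)
      subset_closure)
    have hcc : ContinuousAt (fun y => θ y - c (g y - t)) y0 :=
      hθ.continuousAt.sub (hc.continuousAt.comp (hgc.sub continuousAt_const))
    have hev := (hcc.eventually (Metric.ball_mem_nhds _ (ε := 1 / 4) (by norm_num))).and
      (hWo.eventually_mem hy0W)
    obtain ⟨y1, h1, h1c, h1W⟩ := ((frequently_lt_of_fderiv_ne_zero (hdg y0 (hCQ hy0))).and_eventually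
      hev).exists
    obtain ⟨y2, h2, h2c, h2W⟩ := ((frequently_gt_of_fderiv_ne_zero (hdg y0 (hCQ hy0))).and_eventually
      hev).exists
    rw [hCt y0 hy0] at h1 h2
    have hy1 : y1 ∈ Cᶜ := fun h => h1.ne (hCt _ h)
    have hy2 : y2 ∈ Cᶜ := fun h => h2.ne' (hCt _ h)
    have hk12 : k y1 ≠ k y2 := by
      intro hkk
      have e1 : k y1 = θ y1 - c (g y1 - t) - 1 := by
        simp only [k, κ, j, h1W, if_true]
        rw [abs_of_neg (by linarith), div_neg, div_self (by linarith)]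
        ring
      have e2 : k y2 = θ y2 - c (g y2 - t) + 1 := by
        simp only [k, κ, j, h2W, if_true]
        rw [abs_of_pos (by linarith), div_self (by linarith)]
        ring
      simp only [Real.dist_eq, abs_lt] at h1c h2c
      linarith [h1c.1, h1c.2, h2c.1, h2c.2]
    by_cases hkm : k y1 = m
    · exact ⟨y2, hy2, fun h => hk12 (hkm.trans h.symm)⟩
    · exact ⟨y1, hy1, hkm⟩
  obtain ⟨y, hy, hy'⟩ := exists_fderiv_eq_zero_of_frontier_subset_levelSet hBo hBne
    ((isCompact_closedBall _ _).of_isClosed_subset isClosed_closure hBQ')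
    (hg.mono (hBQ'.trans hQU)) hBC
  exact hdg y (hBQ hy) hy'

/-- The real line with the discrete topology. -/
def DiscreteReal : Type := ℝ

instance : TopologicalSpace DiscreteReal := ⊥
instance : DiscreteTopology DiscreteReal := ⟨rfl⟩

/-- The covering space of branches of a multivalued function whose local branches `g i` differ
by locally constant functions. -/
def branchBundle {X : Type*} [TopologicalSpace X] (V : X → Set X) (g : X → X → ℝ)
    (hV : ∀ i, IsOpen (V i)) (hmem : ∀ i, i ∈ V i)
    (hg : ∀ i j, ∀ x ∈ V i ∩ V j, ∀ᶠ y in 𝓝 x, g i y - g j y = g i x - g j x) :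
    FiberBundleCore X X DiscreteReal where
  baseSet := V
  isOpen_baseSet := hV
  indexAt := id
  mem_baseSet_at := hmem
  coordChange i j x s := (show ℝ from s) + (g i x - g j x)
  coordChange_self i x _ v := by
    change (show ℝ from v) + (g i x - g i x) = v
    rw [sub_self, add_zero]
  continuousOn_coordChange i j := by
    rintro ⟨x, s⟩ hx
    refine ContinuousAt.continuousWithinAt ?_
    refine ContinuousAt.congr (f := fun _ : X × DiscreteReal =>
      (show DiscreteReal from (show ℝ from s) + (g i x - g j x))) continuousAt_const ?_
    have h1 : ∀ᶠ p : X × DiscreteReal in 𝓝 (x, s), g i p.1 - g j p.1 = g i x - g j x :=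
      ((continuous_fst.tendsto (x, s)).eventually (hg i j x hx.1) :)
    have h2 : ∀ᶠ p : X × DiscreteReal in 𝓝 (x, s), p.2 ∈ ({s} : Set DiscreteReal) :=
      continuous_snd.continuousAt.eventually ((isOpen_discrete {s}).mem_nhds rfl)
    filter_upwards [h1, h2] with p hp1 hp2
    rw [hp1, show p.2 = s from hp2]
  coordChange_comp i j k x _ v := by
    change (show ℝ from v) + (g i x - g j x) + (g j x - g k x) = (show ℝ from v) + (g i x - g k x)
    ring

/-- On a simply connected, locally path connected space, local functions which differ pairwise by
locally constant functions can be glued after adding locally constant functions. -/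
theorem exists_global_branch {X : Type*} [TopologicalSpace X] [SimplyConnectedSpace X]
    [LocallyPathConnectedSpace X] (V : X → Set X) (g : X → X → ℝ)
    (hV : ∀ i, IsOpen (V i)) (hmem : ∀ i, i ∈ V i)
    (hg : ∀ i j, ∀ x ∈ V i ∩ V j, ∀ᶠ y in 𝓝 x, g i y - g j y = g i x - g j x) :
    ∃ G : X → ℝ, ∀ i, ∀ x ∈ V i, ∀ᶠ y in 𝓝 x, G y - g i y = G x - g i x := by
  let Z := branchBundle V g hV hmem hg
  obtain ⟨x0⟩ : Nonempty X := inferInstance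
  have hcov : IsCoveringMap Z.proj := FiberBundle.isCoveringMap (F := DiscreteReal) (E := Z.Fiber)
  obtain ⟨F, ⟨-, hF⟩, -⟩ := hcov.existsUnique_continuousMap_lifts (ContinuousMap.id X) x0
    (⟨x0, (show DiscreteReal from (0 : ℝ))⟩ : Z.TotalSpace) rfl
  have hF1 : ∀ x, (F x).1 = x := fun x => congrFun hF x
  let s : X → ℝ := fun x => (F x).2
  refine ⟨fun x => s x + g x x, fun i x hx => ?_⟩
  have hc : ContinuousAt (fun y => (Z.localTriv i (F y)).2) x := by
    have : ContinuousAt (fun y => Z.localTriv i (F y)) x := by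
      refine ContinuousAt.comp (g := Z.localTriv i) ?_ F.continuous.continuousAt
      refine (Z.localTriv i).continuousAt ?_
      rw [Z.mem_localTriv_source]
      change (F x).1 ∈ V i
      rw [hF1]; exact hx
    exact continuous_snd.continuousAt.comp this
  have hev : ∀ᶠ y in 𝓝 x, (Z.localTriv i (F y)).2 = (Z.localTriv i (F x)).2 :=
    hc.eventually
      (p := fun d : DiscreteReal => d = (Z.localTriv i (F x)).2)
      ((isOpen_discrete {(Z.localTriv i (F x)).2}).mem_nhds rfl)
  have key : ∀ y, (Z.localTriv i (F y)).2 = s y + (g y y - g i y) := by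
    intro y
    change s y + (g (F y).1 (F y).1 - g i (F y).1) = _
    rw [hF1]
  filter_upwards [hev] with y hy
  rw [key, key] at hy
  have : s y + (g y y - g i y) = s x + (g x x - g i x) := hy
  linarith

lemma fderiv_eq_zero_of_re_eq_zero {E : Type*} [NormedAddCommGroup E] [NormedSpace ℂ E]
    {f : E → ℂ} {x : E} (hf : DifferentiableAt ℂ f x) (hre : ∀ᶠ y in 𝓝 x, (f y).re = 0) :
    fderiv ℂ f x = 0 := by
  have h1 : HasFDerivAt (fun y => (f y).re)
      (Complex.reCLM.comp ((fderiv ℂ f x).restrictScalars ℝ)) x :=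
    Complex.reCLM.hasFDerivAt.comp x (hf.hasFDerivAt.restrictScalars ℝ)
  have h2 : HasFDerivAt (fun y => (f y).re) (0 : E →L[ℝ] ℝ) x :=
    (hasFDerivAt_const (0 : ℝ) x).congr_of_eventuallyEq hre
  have h3 := h1.unique h2
  have h4 : ∀ v, (fderiv ℂ f x v).re = 0 := fun v => by
    simpa using DFunLike.congr_fun h3 v
  ext v
  apply Complex.ext
  · simpa using h4 v
  · have := h4 (Complex.I • v)
    rw [map_smul] at this
    simpa using this

lemma eventually_eq_of_re_eq_zero {E : Type*} [NormedAddCommGroup E] [NormedSpace ℂ E]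
    {f : E → ℂ} {V : Set E} (hV : IsOpen V) (hf : DifferentiableOn ℂ f V)
    (hre : ∀ y ∈ V, (f y).re = 0) {x : E} (hx : x ∈ V) : ∀ᶠ y in 𝓝 x, f y = f x := by
  have h0 : V.EqOn (fderiv ℂ f) 0 := fun y hy =>
    fderiv_eq_zero_of_re_eq_zero (hf.differentiableAt (hV.mem_nhds hy))
      (Filter.mem_of_superset (hV.mem_nhds hy) hre)
  let _ : NormedSpace ℝ E := NormedSpace.restrictScalars ℝ ℂ E
  filter_upwards [(hV.isOpen_inter_preimage_of_fderiv_eq_zero hf h0 {f x}).mem_nhds ⟨hx, rfl⟩]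
    with y hy using hy.2

/-- A pluriharmonic function on a simply connected open set is the real part of a holomorphic
function. -/
theorem exists_differentiableOn_re_eq {E : Type*} [NormedAddCommGroup E] [NormedSpace ℂ E]
    {Ω : Set E} (hΩ : IsOpen Ω) [SimplyConnectedSpace Ω] {h : E → ℝ}
    (hpl : ∀ z ∈ Ω, ∃ V : Set E, IsOpen V ∧ z ∈ V ∧ V ⊆ Ω ∧
      ∃ g : E → ℂ, DifferentiableOn ℂ g V ∧ ∀ w ∈ V, h w = (g w).re) :
    ∃ f : E → ℂ, DifferentiableOn ℂ f Ω ∧ ∀ z ∈ Ω, (f z).re = h z := by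
  let _ : NormedSpace ℝ E := NormedSpace.restrictScalars ℝ ℂ E
  have : LocallyPathConnectedSpace Ω := hΩ.locallyPathConnectedSpace
  choose V hVo hzV hVΩ g hgd hgh using hpl
  obtain ⟨G, hG⟩ := exists_global_branch (X := Ω) (fun i => Subtype.val ⁻¹' V i.1 i.2)
    (fun i x => (g i.1 i.2 x).im) (fun i => (hVo _ _).preimage continuous_subtype_val)
    (fun i => hzV _ _) (by
      rintro i j x ⟨hxi, hxj⟩
      have := eventually_eq_of_re_eq_zero ((hVo i.1 i.2).inter (hVo j.1 j.2))
        (((hgd i.1 i.2).mono inter_subset_left).sub ((hgd j.1 j.2).mono inter_subset_right))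
        (fun y hy => by simp [← hgh _ i.2 y hy.1, ← hgh _ j.2 y hy.2]) ⟨hxi, hxj⟩
      filter_upwards [continuous_subtype_val.continuousAt.eventually this] with y hy
      simpa using congrArg Complex.im hy)
  classical
  let f : E → ℂ := fun z => if hz : z ∈ Ω then ⟨h z, G ⟨z, hz⟩⟩ else 0
  refine ⟨f, fun z hz => ?_, fun z hz => by simp [f, hz]⟩
  refine DifferentiableAt.differentiableWithinAt ?_
  have h1 : ∀ᶠ y : E in 𝓝 z, ∀ hy : y ∈ Ω,
      G ⟨y, hy⟩ - (g z hz y).im = G ⟨z, hz⟩ - (g z hz z).im := by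
    have := hG ⟨z, hz⟩ ⟨z, hz⟩ (hzV z hz)
    rw [nhds_subtype_eq_comap, eventually_comap] at this
    filter_upwards [this] with y hy hyΩ using hy ⟨y, hyΩ⟩ rfl
  have h2 : (fun y => g z hz y + Complex.I * (G ⟨z, hz⟩ - (g z hz z).im : ℝ)) =ᶠ[𝓝 z] f := by
    filter_upwards [h1, (hVo z hz).mem_nhds (hzV z hz)] with y hy hyV
    have hyΩ := hVΩ z hz hyV
    apply Complex.ext
    · simp [f, hyΩ, hgh z hz y hyV]
    · have := hy hyΩ
      simp [f, hyΩ]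
      linarith
  exact (((hgd z hz).differentiableAt ((hVo z hz).mem_nhds (hzV z hz))).add_const _).congr_of_eventuallyEq
    h2.symm

section Coordinates

variable {𝕜 E F G : Type*} [RCLike 𝕜]
  [NormedAddCommGroup E] [NormedSpace 𝕜 E] [FiniteDimensional 𝕜 E]
  [NormedAddCommGroup F] [NormedSpace 𝕜 F] [FiniteDimensional 𝕜 F]
  [NormedAddCommGroup G] [NormedSpace 𝕜 G] [FiniteDimensional 𝕜 G]

lemma exists_equiv_eq_prod (hdim : Module.finrank 𝕜 E = Module.finrank 𝕜 (F × G))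
    {D : E →L[𝕜] F} {L : E →L[𝕜] G} (hDL : ∀ v, D v = 0 → L v = 0 → v = 0) :
    ∃ A : E ≃L[𝕜] F × G, (A : E →L[𝕜] F × G) = D.prod L := by
  have hinj : Function.Injective ((D.prod L : E →L[𝕜] F × G) : E →ₗ[𝕜] F × G) := by
    rw [← LinearMap.ker_eq_bot, LinearMap.ker_eq_bot']
    intro v hv
    have hv' : (D v, L v) = (0, 0) := hv
    exact hDL v (congrArg Prod.fst hv') (congrArg Prod.snd hv')
  refine ⟨(LinearEquiv.ofInjectiveOfFinrankEq _ hinj hdim).toContinuousLinearEquiv, ?_⟩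
  ext v <;> rfl

/-- Two functions with complementary derivatives form local coordinates. -/
lemma exists_openPartialHomeomorph_prodMk
    (hdim : Module.finrank 𝕜 E = Module.finrank 𝕜 (F × G))
    {f : E → F} {g : E → G} {D : E →L[𝕜] F} {L : E →L[𝕜] G} {x : E}
    (hf : HasStrictFDerivAt f D x) (hg : HasStrictFDerivAt g L x)
    (hDL : ∀ v, D v = 0 → L v = 0 → v = 0) :
    ∃ e : OpenPartialHomeomorph E (F × G), x ∈ e.source ∧ ∀ z, e z = (f z, g z) := by
  obtain ⟨A, hA⟩ := exists_equiv_eq_prod hdim hDL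
  have := FiniteDimensional.complete 𝕜 E
  have hs : HasStrictFDerivAt (fun z => (f z, g z)) (A : E →L[𝕜] F × G) x := by
    rw [hA]; exact hf.prodMk hg
  exact ⟨hs.toOpenPartialHomeomorph _, hs.mem_toOpenPartialHomeomorph_source, fun z => rfl⟩

lemma contDiffAt_symm_prodMk
    (hdim : Module.finrank 𝕜 E = Module.finrank 𝕜 (F × G))
    {f : E → F} {g : E → G} {D : E →L[𝕜] F} {L : E →L[𝕜] G} {x : E}
    (hf : HasFDerivAt f D x) (hg : HasFDerivAt g L x)
    (hDL : ∀ v, D v = 0 → L v = 0 → v = 0) {e : OpenPartialHomeomorph E (F × G)}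
    (hx : x ∈ e.source) (he : ∀ z, e z = (f z, g z)) (hfc : ContDiffAt 𝕜 1 f x)
    (hgc : ContDiffAt 𝕜 1 g x) : ContDiffAt 𝕜 1 e.symm (f x, g x) := by
  obtain ⟨A, hA⟩ := exists_equiv_eq_prod hdim hDL
  have := FiniteDimensional.complete 𝕜 E
  have hfun : (e : E → F × G) = fun z => (f z, g z) := funext he
  have hx' : e.symm (f x, g x) = x := by rw [← he, e.left_inv hx]
  refine e.contDiffAt_symm (f₀' := A) (by rw [← he]; exact e.map_source hx) ?_ ?_
  · rw [hx', hA, hfun]; exact hf.prodMk hg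
  · rw [hx', hfun]; exact hfc.prodMk hgc

end Coordinates

/-- The affine polynomial `z ↦ a₀ (z₀ - x₀) + a₁ (z₁ - x₁)`. -/
def affinePoly (a x : Fin 2 → ℂ) : MvPolynomial (Fin 2) ℂ :=
  MvPolynomial.C (a 0) * (MvPolynomial.X 0 - MvPolynomial.C (x 0)) +
    MvPolynomial.C (a 1) * (MvPolynomial.X 1 - MvPolynomial.C (x 1))

@[simp] lemma eval_affinePoly (a x z : Fin 2 → ℂ) :
    MvPolynomial.eval z (affinePoly a x) = a 0 * (z 0 - x 0) + a 1 * (z 1 - x 1) := by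
  simp [affinePoly]

lemma hasStrictFDerivAt_eval (p : MvPolynomial (Fin 2) ℂ) (x : Fin 2 → ℂ) :
    ∃ D : (Fin 2 → ℂ) →L[ℂ] ℂ, HasStrictFDerivAt (fun z => MvPolynomial.eval z p) D x :=
  ⟨_, (AnalyticOnNhd.eval_mvPolynomial p x (mem_univ x)).hasStrictFDerivAt⟩

/-- The linear form `v ↦ a₀ v₀ + a₁ v₁`. -/
def linForm (a : Fin 2 → ℂ) : (Fin 2 → ℂ) →L[ℂ] ℂ :=
  a 0 • ContinuousLinearMap.proj 0 + a 1 • ContinuousLinearMap.proj 1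

@[simp] lemma linForm_apply (a v : Fin 2 → ℂ) : linForm a v = a 0 * v 0 + a 1 * v 1 := by
  simp [linForm]

lemma exists_eq_linForm (D : (Fin 2 → ℂ) →L[ℂ] ℂ) : ∃ a, D = linForm a := by
  refine ⟨fun i => D (Pi.single i 1), ContinuousLinearMap.ext fun v => ?_⟩
  have : v = v 0 • Pi.single 0 1 + v 1 • Pi.single 1 1 := by
    ext i; fin_cases i <;> simp
  conv_lhs => rw [this]
  simp [mul_comm]

lemma hasStrictFDerivAt_affinePoly (a x y : Fin 2 → ℂ) :
    HasStrictFDerivAt (fun z => MvPolynomial.eval z (affinePoly a x)) (linForm a) y := by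
  have h1 : HasStrictFDerivAt (fun z : Fin 2 → ℂ => linForm a z - linForm a x) (linForm a) y :=
    (linForm a).hasStrictFDerivAt.sub_const _
  refine h1.congr_of_eventuallyEq (Eventually.of_forall fun z => ?_)
  simp; ring

/-- The form complementary to `linForm a`. -/
def conjForm (a : Fin 2 → ℂ) : Fin 2 → ℂ := ![-star (a 1), star (a 0)]

lemma eq_of_forms_eq_zero {a : Fin 2 → ℂ} (ha : a ≠ 0) {η s t : ℂ}
    (h1 : a 0 * s + a 1 * t = 0)
    (h2 : (conjForm a 0 * s + conjForm a 1 * t) + η * (a 0 * s + a 1 * t) = 0) :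
    s = 0 ∧ t = 0 := by
  rw [h1, mul_zero, add_zero] at h2
  simp only [conjForm, Matrix.cons_val_zero, Matrix.cons_val_one] at h2
  have hN : a 0 * star (a 0) + a 1 * star (a 1) ≠ 0 := by
    have hz : a 0 * star (a 0) + a 1 * star (a 1) = ((‖a 0‖ ^ 2 + ‖a 1‖ ^ 2 : ℝ) : ℂ) := by
      simp [Complex.mul_conj, Complex.normSq_eq_norm_sq]
    rw [hz]
    refine Complex.ofReal_ne_zero.2 fun h => ha ?_
    have h0 : ‖a 0‖ = 0 := by nlinarith [sq_nonneg ‖a 0‖, sq_nonneg ‖a 1‖]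
    have h1 : ‖a 1‖ = 0 := by nlinarith [sq_nonneg ‖a 0‖, sq_nonneg ‖a 1‖]
    ext i; fin_cases i
    · simpa using h0
    · simpa using h1
  constructor
  · have : (a 0 * star (a 0) + a 1 * star (a 1)) * s = 0 := by
      linear_combination star (a 0) * h1 - a 1 * h2
    exact (mul_eq_zero.1 this).resolve_left hN
  · have : (a 0 * star (a 0) + a 1 * star (a 1)) * t = 0 := by
      linear_combination star (a 1) * h1 + a 0 * h2
    exact (mul_eq_zero.1 this).resolve_left hN

lemma notMem_polyHull_of_subset_insert {R : Set (Fin 2 → ℂ)} {x : Fin 2 → ℂ} (hR : IsCompact R)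
    (hsub : polyHull 2 R ⊆ insert x R) (d : MvPolynomial (Fin 2) ℂ)
    (hd : ∀ z ∈ R, MvPolynomial.eval z d ≠ MvPolynomial.eval x d) : x ∉ polyHull 2 R := by
  intro hx
  set a : (Fin 2 → ℂ) → ℂ := fun z => MvPolynomial.eval z d
  have haR : a x ∉ a '' R := by
    rintro ⟨z, hz, h⟩
    exact hd z hz h
  have hcl : IsClosed (a '' R) := (hR.image (MvPolynomial.continuous_eval d)).isClosed
  refine haR (frontier_image_polyHull_subset hR d ⟨subset_closure ⟨x, hx, rfl⟩, fun h_int => ?_⟩)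
  have h1 : ∀ᶠ w in 𝓝 (a x), w = a x := by
    filter_upwards [mem_interior_iff_mem_nhds.1 h_int, hcl.isOpen_compl.mem_nhds haR] with w hw hwR
    obtain ⟨z, hz, rfl⟩ := hw
    rcases hsub hz with rfl | hzR
    · rfl
    · exact absurd ⟨z, hzR, rfl⟩ hwR
  have h2 : ∃ᶠ w in 𝓝[≠] (a x), w = a x := (h1.filter_mono nhdsWithin_le_nhds).frequently
  obtain ⟨w, hw1, hw2⟩ := (h2.and_eventually self_mem_nhdsWithin).exists
  exact hw2 hw1

/-- Zero sets of polynomials on `E` can be avoided by small perturbations. -/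
def PolyGeneric (E : Set (Fin 2 → ℂ)) : Prop :=
  ∀ u v : MvPolynomial (Fin 2) ℂ,
    (∀ e ∈ E, MvPolynomial.eval e u = 0 → MvPolynomial.eval e v ≠ 0) → ∀ ε > (0 : ℝ), ∃ η : ℂ,
      ‖η‖ < ε ∧ ∀ e ∈ E, MvPolynomial.eval e u + η * MvPolynomial.eval e v ≠ 0

/-- If near `x` the hull lies in a smooth holomorphic curve `f = f x`, then it fills the curve
near `x`. -/
theorem eventually_mem_polyHull_of_eq {E Ω : Set (Fin 2 → ℂ)} (hE : IsCompact E)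
    (hgen : PolyGeneric E) (hΩ : IsOpen Ω) {f : (Fin 2 → ℂ) → ℂ} {x : Fin 2 → ℂ}
    (hxΩ : x ∈ Ω) (hx : x ∈ polyHull 2 E) (hxE : x ∉ E)
    (hX : ∀ z ∈ polyHull 2 E, z ∈ Ω → f z = f x)
    {D : (Fin 2 → ℂ) →L[ℂ] ℂ} (hD : HasStrictFDerivAt f D x) (hD0 : D ≠ 0) :
    ∀ᶠ z in 𝓝 x, f z = f x → z ∈ polyHull 2 E := by
  obtain ⟨d, rfl⟩ := exists_eq_linForm D
  have hd0 : d ≠ 0 := by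
    rintro rfl
    exact hD0 (by ext v; simp)
  have hXc : IsCompact (polyHull 2 E) := isCompact_polyHull
  -- a generic line through `x` transverse to the curve
  obtain ⟨η, -, hη⟩ := hgen (affinePoly (conjForm d) x) (affinePoly d x) (by
    intro e he h1 h2
    rw [eval_affinePoly] at h1 h2
    obtain ⟨h3, h4⟩ := eq_of_forms_eq_zero (η := 0) hd0 h2 (by rw [h1]; simp)
    refine hxE ?_
    convert he
    ext i; fin_cases i
    · exact (sub_eq_zero.1 h3).symm
    · exact (sub_eq_zero.1 h4).symm) 1 one_pos
  set l : MvPolynomial (Fin 2) ℂ := affinePoly (conjForm d + η • d) x with hl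
  have hleval : ∀ z, MvPolynomial.eval z l = (conjForm d 0 * (z 0 - x 0) +
      conjForm d 1 * (z 1 - x 1)) + η * (d 0 * (z 0 - x 0) + d 1 * (z 1 - x 1)) := by
    intro z; simp [hl]; ring
  have hlE : ∀ e ∈ E, MvPolynomial.eval e l ≠ 0 := fun e he => by
    have := hη e he
    rw [eval_affinePoly, eval_affinePoly] at this
    rwa [hleval]
  have hlx : MvPolynomial.eval x l = 0 := by simp [hl]
  have hinj : ∀ z, MvPolynomial.eval z l = 0 → MvPolynomial.eval z (affinePoly d x) = 0 →
      z = x := by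
    intro z h1 h2
    rw [hleval] at h1
    rw [eval_affinePoly] at h2
    obtain ⟨h3, h4⟩ := eq_of_forms_eq_zero hd0 h2 h1
    ext i; fin_cases i
    · exact (sub_eq_zero.1 h3)
    · exact (sub_eq_zero.1 h4)
  have hforms : ∀ v, linForm d v = 0 → linForm (conjForm d + η • d) v = 0 → v = 0 := by
    intro v h1 h2
    rw [linForm_apply] at h1 h2
    obtain ⟨h3, h4⟩ := eq_of_forms_eq_zero (η := η) hd0 h1 (by
      simp only [Pi.add_apply, Pi.smul_apply, smul_eq_mul] at h2
      linear_combination h2)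
    ext i; fin_cases i
    · exact h3
    · exact h4
  have hdim : Module.finrank ℂ (Fin 2 → ℂ) = Module.finrank ℂ (ℂ × ℂ) := by simp
  have hlD := hasStrictFDerivAt_affinePoly (conjForm d + η • d) x x
  obtain ⟨e1, hxe1, he1⟩ := exists_openPartialHomeomorph_prodMk hdim hD hlD hforms
  -- the rest of the line in the hull
  set R : Set (Fin 2 → ℂ) := (polyHull 2 E ∩ {z | MvPolynomial.eval z l = 0}) \ (e1.source ∩ Ω)
    with hRdef
  have hlcl : IsClosed {z | MvPolynomial.eval z l = 0} :=
    isClosed_eq (MvPolynomial.continuous_eval l) continuous_const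
  have hRc : IsCompact R := (hXc.inter_right hlcl).diff (e1.open_source.inter hΩ)
  have hX0 : ∀ z ∈ polyHull 2 E, MvPolynomial.eval z l = 0 → z = x ∨ z ∈ R := by
    intro z hz hzl
    by_cases hzN : z ∈ e1.source ∩ Ω
    · left
      refine e1.injOn hzN.1 hxe1 ?_
      rw [he1, he1, hX z hz hzN.2]
      exact congrArg _ (hzl.trans hlx.symm)
    · exact Or.inr ⟨⟨hz, hzl⟩, hzN⟩
  have hxR : x ∉ polyHull 2 R := by
    refine notMem_polyHull_of_subset_insert hRc (fun z hz => ?_) (affinePoly d x) ?_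
    · have h1 : z ∈ polyHull 2 E := polyHull_mono hRc hE (fun w hw => hw.1.1) hz
      have h2 : MvPolynomial.eval z l = 0 := by
        rw [← norm_le_zero_iff]
        exact (mem_polyHull_iff hRc).1 hz l 0 fun w hw => by
          rw [show MvPolynomial.eval w l = 0 from hw.1.2, norm_zero]
      exact hX0 z h1 h2
    · intro z hz h
      rw [show MvPolynomial.eval x (affinePoly d x) = 0 by simp] at h
      have := hinj z hz.1.2 h
      subst this
      exact hz.2 ⟨hxe1, hxΩ⟩
  rw [mem_polyHull_iff hRc] at hxR
  push Not at hxR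
  obtain ⟨p, C, hpR, hpx⟩ := hxR
  -- a polynomial vanishing on the line only at `x`
  set F : MvPolynomial (Fin 2) ℂ := l + (p - MvPolynomial.C (MvPolynomial.eval x p)) ^ 2 with hF
  have hFx : MvPolynomial.eval x F = 0 := by simp [hF, hlx]
  have hF0 : ∀ z ∈ polyHull 2 E, MvPolynomial.eval z l = 0 → MvPolynomial.eval z F = 0 →
      z = x := by
    intro z hz hzl hzF
    refine (hX0 z hz hzl).resolve_right fun hzR => ?_
    have : MvPolynomial.eval z p = MvPolynomial.eval x p := by
      simp only [hF, map_add, map_pow, map_sub, MvPolynomial.eval_C, hzl, zero_add] at hzF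
      exact sub_eq_zero.1 (pow_eq_zero_iff two_ne_zero |>.1 hzF)
    have h1 := hpR z hzR
    rw [this] at h1
    exact absurd h1 (not_le.2 hpx)
  have hFD : HasStrictFDerivAt (fun z => MvPolynomial.eval z F) (linForm (conjForm d + η • d)) x := by
    obtain ⟨P, hP⟩ := hasStrictFDerivAt_eval p x
    have h1 := (hP.sub_const (MvPolynomial.eval x p)).pow 2
    rw [sub_self, zero_pow (by norm_num), smul_zero] at h1
    have h1' : HasStrictFDerivAt (fun z => (MvPolynomial.eval z p - MvPolynomial.eval x p) ^ 2)
        (0 : (Fin 2 → ℂ) →L[ℂ] ℂ) x := h1.congr_fderiv (ContinuousLinearMap.ext fun v => zero_mul _)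
    have h2 := hlD.add h1'
    rw [add_zero] at h2
    exact h2.congr_of_eventuallyEq (Eventually.of_forall fun z => by simp [hF, hl])
  obtain ⟨e2, hxe2, he2⟩ := exists_openPartialHomeomorph_prodMk hdim hD hFD hforms
  set N := e2.source ∩ Ω with hN
  have hNo : IsOpen N := e2.open_source.inter hΩ
  have hxN : x ∈ N := ⟨hxe2, hxΩ⟩
  have hNinj : ∀ y ∈ N, ∀ z ∈ N, f y = f x → f z = f x →
      MvPolynomial.eval y F = MvPolynomial.eval z F → y = z := by
    intro y hy z hz h1 h2 h3
    refine e2.injOn hy.1 hz.1 ?_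
    rw [he2, he2, h1, h2, h3]
  obtain ⟨r1, hr1, hr1E⟩ := hE.exists_forall_le' (a := (0 : ℝ))
    (MvPolynomial.continuous_eval l).norm.continuousOn fun e he => norm_pos_iff.2 (hlE e he)
  obtain ⟨r2, hr2, hr2X⟩ := (hXc.diff hNo).exists_forall_le' (a := (0 : ℝ))
    (f := fun z => max ‖MvPolynomial.eval z l‖ ‖MvPolynomial.eval z F‖)
    ((MvPolynomial.continuous_eval l).norm.max (MvPolynomial.continuous_eval F).norm).continuousOn
    (fun z hz => by
      by_contra hcon
      have hcon := not_lt.1 hcon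
      have h1 := norm_le_zero_iff.1 ((le_max_left _ _).trans hcon)
      have h2 := norm_le_zero_iff.1 ((le_max_right _ _).trans hcon)
      have := hF0 z hz.1 h1 h2
      subst this
      exact hz.2 hxN)
  obtain ⟨r, hr, hrr1, hrr2⟩ : ∃ r > 0, r < r1 ∧ r < r2 :=
    ⟨min r1 r2 / 2, by positivity, by linarith [min_le_left r1 r2, lt_min hr1 hr2],
      by linarith [min_le_right r1 r2, lt_min hr1 hr2]⟩
  have hsmall : ∀ z ∈ polyHull 2 E, ‖MvPolynomial.eval z l‖ ≤ r → ‖MvPolynomial.eval z F‖ ≤ r →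
      z ∈ N := by
    intro z hz h1 h2
    by_contra hzN
    exact absurd (hr2X z ⟨hz, hzN⟩) (not_le.2 ((max_le h1 h2).trans_lt hrr2))
  set E' := polyHull 2 E ∩ {z | ‖MvPolynomial.eval z l - 0‖ = r} with hE'
  have hE'c : IsCompact E' := hXc.inter_right
    (isClosed_eq ((MvPolynomial.continuous_eval l).sub continuous_const).norm continuous_const)
  have hxH : x ∈ polyHull 2 E' :=
    polyHull_inter_subset hE l hr (fun w hw => by rw [sub_zero]; exact hrr1.trans_le (hr1E w hw))
      ⟨hx, by simpa [hlx] using hr.le⟩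
  have hHX : polyHull 2 E' ⊆ polyHull 2 E := polyHull_mono hE'c hE fun w hw => hw.1
  have hHl : ∀ z ∈ polyHull 2 E', ‖MvPolynomial.eval z l‖ ≤ r := fun z hz =>
    (mem_polyHull_iff hE'c).1 hz l r fun w hw => by
      have : ‖MvPolynomial.eval w l - 0‖ = r := hw.2
      rw [sub_zero] at this; exact this.le
  have h_int : (0 : ℂ) ∈ interior ((fun z => MvPolynomial.eval z F) '' polyHull 2 E') := by
    by_contra hcon
    obtain ⟨z, hz, hzF⟩ := frontier_image_polyHull_subset hE'c F
      ⟨subset_closure ⟨x, hxH, hFx⟩, hcon⟩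
    have hzr : ‖MvPolynomial.eval z l - 0‖ = r := hz.2
    rw [sub_zero] at hzr
    have hzN := hsmall z hz.1 hzr.le (by
      rw [show MvPolynomial.eval z F = 0 from hzF]; simpa using hr.le)
    have := hNinj z hzN x hxN (hX z hz.1 hzN.2) rfl (hzF.trans hFx.symm)
    subst this
    rw [hlx, norm_zero] at hzr
    exact hr.ne hzr
  have hcF : Tendsto (fun z => MvPolynomial.eval z F) (𝓝 x) (𝓝 0) := by
    have := (MvPolynomial.continuous_eval F).tendsto x
    rwa [hFx] at this
  filter_upwards [hcF (mem_interior_iff_mem_nhds.1 h_int), hNo.mem_nhds hxN,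
    hcF (Metric.closedBall_mem_nhds 0 hr)] with y ⟨z, hz, hzy⟩ hyN hyr hfy
  have hyr' : ‖MvPolynomial.eval y F‖ ≤ r := by simpa using hyr
  have hzN := hsmall z (hHX hz) (hHl z hz) (by
    rw [show MvPolynomial.eval z F = MvPolynomial.eval y F from hzy]; exact hyr')
  rw [hNinj y hyN z hzN hfy (hX z (hHX hz) hzN.2) hzy.symm]
  exact hHX hz

/-- The real part of a polynomial has no strict local maximum on a smooth holomorphic curve. -/
lemma not_eventually_re_lt_on_curve {f : (Fin 2 → ℂ) → ℂ} {x : Fin 2 → ℂ}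
    (hf : ContDiffAt ℂ 1 f x) (hD0 : fderiv ℂ f x ≠ 0) (u : MvPolynomial (Fin 2) ℂ) :
    ¬ ∀ᶠ z in 𝓝 x, f z = f x → z ≠ x →
      (MvPolynomial.eval z u).re < (MvPolynomial.eval x u).re := by
  intro hmax
  obtain ⟨d, hd⟩ := exists_eq_linForm (fderiv ℂ f x)
  have hd0 : d ≠ 0 := by
    rintro rfl
    exact hD0 (hd.trans (by ext v; simp))
  have hfs : HasStrictFDerivAt f (linForm d) x := hd ▸ hf.hasStrictFDerivAt one_ne_zero
  set l := affinePoly (conjForm d) x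
  have hls : HasStrictFDerivAt (fun z => MvPolynomial.eval z l) (linForm (conjForm d)) x :=
    hasStrictFDerivAt_affinePoly _ _ _
  have hlx : MvPolynomial.eval x l = 0 := by simp [l]
  have hforms : ∀ v, linForm d v = 0 → linForm (conjForm d) v = 0 → v = 0 := by
    intro v h1 h2
    rw [linForm_apply] at h1 h2
    obtain ⟨h3, h4⟩ := eq_of_forms_eq_zero (η := 0) hd0 h1 (by rw [h2]; simp)
    ext i; fin_cases i
    · exact h3
    · exact h4
  have hdim : Module.finrank ℂ (Fin 2 → ℂ) = Module.finrank ℂ (ℂ × ℂ) := by simp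
  obtain ⟨e, hxe, he⟩ := exists_openPartialHomeomorph_prodMk hdim hfs hls hforms
  have hcd (p : MvPolynomial (Fin 2) ℂ) (z : Fin 2 → ℂ) :
      ContDiffAt ℂ 1 (fun z => MvPolynomial.eval z p) z :=
    (AnalyticOnNhd.eval_mvPolynomial p z (mem_univ z)).contDiffAt
  have hsymm := contDiffAt_symm_prodMk hdim hfs.hasFDerivAt hls.hasFDerivAt hforms hxe he hf
    (hcd l x)
  rw [hlx] at hsymm
  have hex : e.symm (f x, 0) = x := by rw [← hlx, ← he, e.left_inv hxe]
  have hinc : ContDiffAt ℂ 1 (fun s : ℂ => (f x, s)) 0 := contDiffAt_const.prodMk contDiffAt_id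
  have hψ : ContDiffAt ℂ 1 (fun s : ℂ => e.symm (f x, s)) 0 :=
    ContDiffAt.comp (g := e.symm) (0 : ℂ) hsymm hinc
  have hk : ContDiffAt ℂ 1 (fun s : ℂ => Complex.exp (MvPolynomial.eval (e.symm (f x, s)) u)) 0 :=
    (ContDiffAt.comp (g := fun z => MvPolynomial.eval z u) (0 : ℂ) (hcd u _) hψ).cexp
  have hkd : ∀ᶠ s in 𝓝 (0 : ℂ), DifferentiableAt ℂ
      (fun s : ℂ => Complex.exp (MvPolynomial.eval (e.symm (f x, s)) u)) s := by
    filter_upwards [hk.eventually (by simp)] with s hs using hs.differentiableAt one_ne_zero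
  have htgt : ∀ᶠ s in 𝓝 (0 : ℂ), (f x, s) ∈ e.target := by
    refine hinc.continuousAt.eventually (e.open_target.mem_nhds ?_)
    change (f x, (0 : ℂ)) ∈ e.target
    rw [← hlx, ← he]
    exact e.map_source hxe
  have hcoord : ∀ᶠ s in 𝓝 (0 : ℂ), f (e.symm (f x, s)) = f x ∧
      MvPolynomial.eval (e.symm (f x, s)) l = s := by
    filter_upwards [htgt] with s hs
    have := e.right_inv hs
    rw [he, Prod.mk.injEq] at this
    exact this
  have hmaxψ : ∀ᶠ s in 𝓝 (0 : ℂ), s ≠ 0 →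
      (MvPolynomial.eval (e.symm (f x, s)) u).re < (MvPolynomial.eval x u).re := by
    have hc : Tendsto (fun s : ℂ => e.symm (f x, s)) (𝓝 0) (𝓝 x) := by
      have := hψ.continuousAt.tendsto
      rwa [hex] at this
    filter_upwards [hc.eventually hmax, hcoord] with s hs hcs hs0
    refine hs hcs.1 fun h => hs0 ?_
    rw [← hcs.2, h, hlx]
  have hloc : IsLocalMax
      (norm ∘ fun s : ℂ => Complex.exp (MvPolynomial.eval (e.symm (f x, s)) u)) 0 := by
    filter_upwards [hmaxψ] with s hs
    rcases eq_or_ne s 0 with rfl | hs0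
    · exact le_rfl
    · simp only [Function.comp_apply, Complex.norm_exp, hex]
      exact Real.exp_le_exp.2 (hs hs0).le
  have hconst := Complex.eventually_eq_of_isLocalMax_norm hkd hloc
  have hev : ∀ᶠ s in 𝓝[≠] (0 : ℂ), False := by
    filter_upwards [(hconst.and hmaxψ).filter_mono nhdsWithin_le_nhds, self_mem_nhdsWithin]
      with s ⟨h1, h2⟩ hs0
    have h3 := congrArg norm h1
    simp only [Complex.norm_exp, hex, Real.exp_eq_exp] at h3
    exact (h2 hs0).ne h3
  exact (hev.exists).choose_spec

/-- If the hull of `E` lies in a holomorphic curve near `Ω`, and near each point of `E` it either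
fills the curve or reduces to `E`, then there is no hull. -/
theorem polyHull_subset_of_dichotomy {E Ω : Set (Fin 2 → ℂ)} (hE : IsCompact E)
    (hgen : PolyGeneric E) {f : (Fin 2 → ℂ) → ℂ} {c : ℂ} (hEΩ : E ⊆ Ω)
    (hf : ∀ z ∈ Ω, ContDiffAt ℂ 1 f z)
    (hfE : ∀ e ∈ E, f e = c) (hD0 : ∀ e ∈ E, fderiv ℂ f e ≠ 0)
    (hthin : ∀ e ∈ E, ¬ ∀ᶠ z in 𝓝 e, f z = c → z ∈ E)
    (hdich : ∀ e ∈ E, (∀ᶠ z in 𝓝 e, f z = c → z ∈ polyHull 2 E) ∨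
      ∀ᶠ z in 𝓝 e, z ∈ polyHull 2 E → z ∈ E) : polyHull 2 E ⊆ E := by
  set X := polyHull 2 E with hXdef
  have hXc : IsCompact X := isCompact_polyHull
  by_contra hsub
  obtain ⟨z0, hz0X, hz0E⟩ := not_subset.1 hsub
  set B : Set (Fin 2 → ℂ) := {e | e ∈ E ∧ ¬ ∀ᶠ z in 𝓝 e, f z = c → z ∈ X} with hB
  have hBnhds : ∀ e ∈ B, ∀ᶠ z in 𝓝 e, z ∈ X → z ∈ B := by
    rintro e ⟨heE, he⟩
    have h1 := (hdich e heE).resolve_left he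
    filter_upwards [h1, h1.eventually_nhds] with z hz1 hz2 hzX
    refine ⟨hz1 hzX, fun hz3 => hthin z (hz1 hzX) ?_⟩
    filter_upwards [hz2, hz3] with w hw1 hw2 hw3 using hw1 (hw2 hw3)
  have hX'c : IsCompact (X \ B) := by
    refine hXc.of_isClosed_subset ?_ sdiff_subset
    rw [← isOpen_compl_iff, isOpen_iff_mem_nhds]
    intro z hz
    by_cases hzX : z ∈ X
    · have hzB : z ∈ B := by
        by_contra hzB
        exact hz ⟨hzX, hzB⟩
      filter_upwards [hBnhds z hzB] with w hw hw'
      exact hw'.2 (hw hw'.1)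
    · filter_upwards [hXc.isClosed.isOpen_compl.mem_nhds hzX] with w hw hw'
      exact hw hw'.1
  obtain ⟨c0, hc0⟩ : ∃ c0, c0 ∉ X := by
    by_contra! h
    exact hXc.ne_univ (eq_univ_of_forall h)
  obtain ⟨x, ⟨hxX, hxB⟩, hxmax⟩ := hX'c.exists_isMaxOn
    ⟨z0, hz0X, fun h => hz0E h.1⟩
    (f := fun z : Fin 2 → ℂ => Complex.normSq (z 0 - c0 0) + Complex.normSq (z 1 - c0 1))
    (by fun_prop)
  set a : Fin 2 → ℂ := fun i => star (x i - c0 i) with ha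
  have ha0 : a ≠ 0 := by
    intro h
    refine hc0 ?_
    convert hxX using 1
    ext i
    have := congrFun h i
    simp only [ha, Pi.zero_apply, star_eq_zero] at this
    exact (sub_eq_zero.1 this).symm
  set u := affinePoly a x with hu
  have hux : MvPolynomial.eval x u = 0 := by simp [hu]
  have hure : ∀ z ∈ X \ B, (MvPolynomial.eval z u).re ≤
      -(Complex.normSq (z 0 - x 0) + Complex.normSq (z 1 - x 1)) / 2 := by
    intro z hz
    have h1 := hxmax hz
    simp only [mem_ofPred_eq, Complex.normSq_apply, Complex.sub_re, Complex.sub_im] at h1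
    simp only [hu, ha, eval_affinePoly, Complex.normSq_apply, Complex.sub_re, Complex.sub_im,
      Complex.add_re, Complex.mul_re, Complex.star_def, Complex.conj_re, Complex.conj_im]
    linarith
  have hpos : ∀ z, z ≠ x → 0 < Complex.normSq (z 0 - x 0) + Complex.normSq (z 1 - x 1) := by
    intro z hz
    by_contra hcon
    have h0 : Complex.normSq (z 0 - x 0) = 0 := by
      linarith [Complex.normSq_nonneg (z 0 - x 0), Complex.normSq_nonneg (z 1 - x 1)]
    have h1 : Complex.normSq (z 1 - x 1) = 0 := by
      linarith [Complex.normSq_nonneg (z 0 - x 0), Complex.normSq_nonneg (z 1 - x 1)]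
    refine hz ?_
    ext i; fin_cases i
    · exact sub_eq_zero.1 (Complex.normSq_eq_zero.1 h0)
    · exact sub_eq_zero.1 (Complex.normSq_eq_zero.1 h1)
  by_cases hxE : x ∈ E
  · have hfull : ∀ᶠ z in 𝓝 x, f z = c → z ∈ X := by
      by_contra h
      exact hxB ⟨hxE, h⟩
    refine not_eventually_re_lt_on_curve (hf x (hEΩ hxE)) (hD0 x hxE) u ?_
    filter_upwards [hfull, hfull.eventually_nhds] with z hz1 hz2 hz3 hz4
    rw [hfE x hxE] at hz3
    have := hure z ⟨hz1 hz3, fun h => h.2 hz2⟩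
    rw [hux, Complex.zero_re]
    linarith [hpos z hz4]
  · set l := affinePoly (conjForm a) x with hl
    set A := Complex.normSq (a 0) + Complex.normSq (a 1) with hA
    have hA0 : 0 ≤ A := add_nonneg (Complex.normSq_nonneg _) (Complex.normSq_nonneg _)
    have hlbound : ∀ z, ‖MvPolynomial.eval z l‖ ^ 2 ≤
        2 * A * (Complex.normSq (z 0 - x 0) + Complex.normSq (z 1 - x 1)) := by
      intro z
      have h1 : ‖MvPolynomial.eval z l‖ ≤ ‖a 1‖ * ‖z 0 - x 0‖ + ‖a 0‖ * ‖z 1 - x 1‖ := by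
        rw [hl, eval_affinePoly]
        refine (norm_add_le _ _).trans (le_of_eq ?_)
        simp [conjForm]
      rw [hA]
      simp only [Complex.normSq_eq_norm_sq]
      have h2 : ‖MvPolynomial.eval z l‖ ^ 2 ≤ (‖a 1‖ * ‖z 0 - x 0‖ + ‖a 0‖ * ‖z 1 - x 1‖) ^ 2 := by
        gcongr
      nlinarith [sq_nonneg (‖a 1‖ * ‖z 0 - x 0‖ - ‖a 0‖ * ‖z 1 - x 1‖),
        sq_nonneg (‖a 1‖ * ‖z 1 - x 1‖), sq_nonneg (‖a 0‖ * ‖z 0 - x 0‖)]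
    obtain ⟨η, hη, hηE⟩ := hgen u (l ^ 2) (by
      intro e he h1 h2
      rw [map_pow, pow_eq_zero_iff two_ne_zero] at h2
      rw [hu, eval_affinePoly] at h1
      rw [hl, eval_affinePoly] at h2
      obtain ⟨h3, h4⟩ := eq_of_forms_eq_zero (η := 0) ha0 h1 (by rw [h2]; simp)
      refine hxE ?_
      convert he
      ext i; fin_cases i
      · exact (sub_eq_zero.1 h3).symm
      · exact (sub_eq_zero.1 h4).symm) (1 / (4 * (2 * A + 1))) (by positivity)
    set F : MvPolynomial (Fin 2) ℂ := u + MvPolynomial.C η * l ^ 2 with hF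
    have hFev : ∀ z, MvPolynomial.eval z F =
        MvPolynomial.eval z u + η * MvPolynomial.eval z (l ^ 2) := fun z => by simp [hF]
    have hFx : MvPolynomial.eval x F = 0 := by simp [hF, hux, hl]
    have hFE : ∀ e ∈ E, MvPolynomial.eval e F ≠ 0 := fun e he => by
      rw [hFev]; exact hηE e he
    have hFre : ∀ z ∈ X \ B, (MvPolynomial.eval z F).re ≤ 0 := by
      intro z hz
      set S := Complex.normSq (z 0 - x 0) + Complex.normSq (z 1 - x 1) with hS
      have hS0 : 0 ≤ S := add_nonneg (Complex.normSq_nonneg _) (Complex.normSq_nonneg _)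
      have h1 := hure z hz
      have h2 : (η * MvPolynomial.eval z (l ^ 2)).re ≤ S / 4 := by
        refine (Complex.re_le_norm _).trans ?_
        rw [norm_mul, map_pow, norm_pow]
        calc ‖η‖ * ‖MvPolynomial.eval z l‖ ^ 2
            ≤ (1 / (4 * (2 * A + 1))) * (2 * A * S) :=
              mul_le_mul hη.le (hlbound z) (by positivity) (by positivity)
          _ ≤ S / 4 := by
              rw [div_mul_eq_mul_div, one_mul, div_le_div_iff₀ (by positivity) (by norm_num)]
              nlinarith
      rw [hFev, Complex.add_re]
      linarith
    have h0not : (0 : ℂ) ∉ (fun z => MvPolynomial.eval z F) '' E := by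
      rintro ⟨e, he, h⟩
      exact hFE e he h
    have hcl : IsClosed ((fun z => MvPolynomial.eval z F) '' E) :=
      (hE.image (MvPolynomial.continuous_eval F)).isClosed
    refine h0not (frontier_image_polyHull_subset hE F ⟨subset_closure ⟨x, hxX, hFx⟩, fun h_int => ?_⟩)
    have hev : ∀ᶠ w in 𝓝 (0 : ℂ), w.re ≤ 0 := by
      filter_upwards [mem_interior_iff_mem_nhds.1 h_int, hcl.isOpen_compl.mem_nhds h0not]
        with w ⟨z, hz, hzw⟩ hwE
      have hzB : z ∉ B := fun h => hwE ⟨z, h.1, hzw⟩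
      rw [← hzw]
      exact hFre z ⟨hz, hzB⟩
    have hev2 : ∀ᶠ s in 𝓝[>] (0 : ℝ), False := by
      have hc : Tendsto (fun s : ℝ => (s : ℂ)) (𝓝 0) (𝓝 0) :=
        Complex.continuous_ofReal.tendsto' 0 0 (by simp)
      filter_upwards [(hc.eventually hev).filter_mono nhdsWithin_le_nhds, self_mem_nhdsWithin]
        with s hs1 hs2
      exact absurd (mem_Ioi.1 hs2) (not_lt.2 (by simpa using hs1))
    exact (hev2.exists).choose_spec

/-- Near a regular point, both sides of a level set in the plane are connected. -/
lemma exists_open_preconnected_sides {g : ℝ × ℝ → ℝ} {y : ℝ × ℝ} {D : ℝ × ℝ →L[ℝ] ℝ}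
    (hg : HasStrictFDerivAt g D y) (hD : D ≠ 0) {N : Set (ℝ × ℝ)} (hN : N ∈ 𝓝 y) :
    ∃ W, IsOpen W ∧ y ∈ W ∧ W ⊆ N ∧ IsPreconnected (W ∩ {x | g y < g x}) ∧
      IsPreconnected (W ∩ {x | g x < g y}) := by
  set L : ℝ × ℝ →L[ℝ] ℝ :=
    D (1, 0) • ContinuousLinearMap.snd ℝ ℝ ℝ - D (0, 1) • ContinuousLinearMap.fst ℝ ℝ ℝ with hL
  have hDv : ∀ v : ℝ × ℝ, D v = v.1 * D (1, 0) + v.2 * D (0, 1) := by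
    intro v
    have : v = v.1 • ((1, 0) : ℝ × ℝ) + v.2 • ((0, 1) : ℝ × ℝ) := by ext <;> simp
    conv_lhs => rw [this]
    rw [map_add, map_smul, map_smul, smul_eq_mul, smul_eq_mul]
  have hne : D (1, 0) ^ 2 + D (0, 1) ^ 2 ≠ 0 := by
    intro h
    have h1 : D (1, 0) = 0 := by nlinarith [sq_nonneg (D (1, 0)), sq_nonneg (D (0, 1))]
    have h2 : D (0, 1) = 0 := by nlinarith [sq_nonneg (D (1, 0)), sq_nonneg (D (0, 1))]
    exact hD (ContinuousLinearMap.ext fun v => by rw [hDv, h1, h2]; simp)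
  have hforms : ∀ v, D v = 0 → L v = 0 → v = 0 := by
    intro v h1 h2
    rw [hDv] at h1
    have h2' : D (1, 0) * v.2 - D (0, 1) * v.1 = 0 := by simpa [hL] using h2
    ext
    · refine (mul_eq_zero.1 (?_ : (D (1, 0) ^ 2 + D (0, 1) ^ 2) * v.1 = 0)).resolve_left hne
      linear_combination D (1, 0) * h1 - D (0, 1) * h2'
    · refine (mul_eq_zero.1 (?_ : (D (1, 0) ^ 2 + D (0, 1) ^ 2) * v.2 = 0)).resolve_left hne
      linear_combination D (0, 1) * h1 + D (1, 0) * h2'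
  obtain ⟨e, hye, he⟩ := exists_openPartialHomeomorph_prodMk rfl hg
    (L.hasStrictFDerivAt (x := y)) hforms
  have hsymm : Tendsto e.symm (𝓝 (e y)) (𝓝 y) := by
    have := (e.continuousAt_symm (e.map_source hye)).tendsto
    rwa [e.left_inv hye] at this
  obtain ⟨r, hr, hball⟩ := Metric.eventually_nhds_iff_ball.1
    ((hsymm.eventually hN).and (e.open_target.mem_nhds (e.map_source hye)))
  set B := Metric.ball (e y) r
  have hW : e.source ∩ e ⁻¹' B = e.symm '' B := by
    rw [e.symm_image_eq_source_inter_preimage (fun x hx => (hball x hx).2)]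
  have hside : ∀ A : Set (ℝ × ℝ), Convex ℝ A →
      IsPreconnected ((e.source ∩ e ⁻¹' B) ∩ e ⁻¹' A) := by
    intro A hA
    have h1 : (e.source ∩ e ⁻¹' B) ∩ e ⁻¹' A = e.symm '' (B ∩ A) := by
      rw [e.symm_image_eq_source_inter_preimage (fun x hx => (hball x hx.1).2), preimage_inter,
        inter_assoc]
    rw [h1]
    exact (((convex_ball _ _).inter hA).isPreconnected).image _
      (e.continuousOn_symm.mono fun x hx => (hball x hx.1).2)
  refine ⟨e.source ∩ e ⁻¹' B, e.isOpen_inter_preimage Metric.isOpen_ball,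
    ⟨hye, Metric.mem_ball_self hr⟩, ?_, ?_, ?_⟩
  · rw [hW]
    rintro _ ⟨x, hx, rfl⟩
    exact (hball x hx).1
  · convert hside {p | g y < p.1} ((convex_Ioi (g y)).linear_preimage (LinearMap.fst ℝ ℝ ℝ)) using 2
    ext x; simp [he]
  · convert hside {p | p.1 < g y} ((convex_Iio (g y)).linear_preimage (LinearMap.fst ℝ ℝ ℝ)) using 2
    ext x; simp [he]

/-- The combinatorial core: a closed set `S` whose part outside `C` is open either fills a
neighbourhood of a point, or lies in `C`, or lies on one side of the level set. -/
lemma sides_trichotomy {g : ℝ × ℝ → ℝ} {y : ℝ × ℝ} {C S W : Set (ℝ × ℝ)} (hW : IsOpen W)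
    (hup : ∀ x ∈ W, ∃ᶠ w in 𝓝 x, g x < g w) (hdown : ∀ x ∈ W, ∃ᶠ w in 𝓝 x, g w < g x)
    (hpre : IsPreconnected (W ∩ {x | g y < g x})) (hpre' : IsPreconnected (W ∩ {x | g x < g y}))
    (hS : ∀ x ∈ W, x ∉ S → ∀ᶠ w in 𝓝 x, w ∉ S)
    (hSo : ∀ x ∈ W, x ∈ S → x ∉ C → ∀ᶠ w in 𝓝 x, w ∈ S) (hC : ∀ x ∈ C, g x = g y) :
    W ⊆ S ∨ W ∩ S ⊆ C ∨ ((∀ x ∈ W, g x = g y → x ∈ C) ∧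
      ∀ x ∈ W, g x = g y → (∃ᶠ w in 𝓝 x, w ∈ S ∧ w ∉ C) ∧ ∃ᶠ w in 𝓝 x, w ∉ S) := by
  have key : ∀ A : Set (ℝ × ℝ), A ⊆ W → Disjoint A C → IsPreconnected A → A ⊆ S ∨ A ∩ S = ∅ := by
    intro A hAW hAC hA
    by_contra! hcon
    obtain ⟨h1, h2⟩ := hcon
    obtain ⟨a, haA, haS⟩ := not_subset.1 h1
    obtain ⟨x, -, hx1, hx2⟩ := hA (interior S) (interior Sᶜ) isOpen_interior isOpen_interior
      (fun x hx => by
        by_cases hxS : x ∈ S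
        · exact Or.inl (mem_interior_iff_mem_nhds.2
            (hSo x (hAW hx) hxS (disjoint_left.1 hAC hx)))
        · exact Or.inr (mem_interior_iff_mem_nhds.2 (hS x (hAW hx) hxS)))
      (by
        obtain ⟨b, hbA, hbS⟩ := h2
        exact ⟨b, hbA, mem_interior_iff_mem_nhds.2
            (hSo b (hAW hbA) hbS (disjoint_left.1 hAC hbA))⟩)
      ⟨a, haA, mem_interior_iff_mem_nhds.2 (hS a (hAW haA) haS)⟩
    exact interior_subset hx2 (interior_subset hx1)
  have hWn : ∀ x ∈ W, ∀ᶠ w in 𝓝 x, w ∈ W := fun x hx => hW.mem_nhds hx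
  have hup' : ∀ x ∈ W, g x = g y → ∃ᶠ w in 𝓝 x, w ∈ W ∩ {x | g y < g x} := by
    intro x hx hxy
    exact ((hup x hx).and_eventually (hWn x hx)).mono fun w hw => ⟨hw.2, hxy ▸ hw.1⟩
  have hdown' : ∀ x ∈ W, g x = g y → ∃ᶠ w in 𝓝 x, w ∈ W ∩ {x | g x < g y} := by
    intro x hx hxy
    exact ((hdown x hx).and_eventually (hWn x hx)).mono fun w hw => ⟨hw.2, hxy ▸ hw.1⟩
  have hupC : Disjoint (W ∩ {x | g y < g x}) C :=
    disjoint_left.2 fun x hx hxC => (hC x hxC).not_gt hx.2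
  have hdownC : Disjoint (W ∩ {x | g x < g y}) C :=
    disjoint_left.2 fun x hx hxC => (hC x hxC).not_lt hx.2
  have one : ∀ A B : Set (ℝ × ℝ), Disjoint A C →
      (∀ x ∈ W, g x = g y → ∃ᶠ w in 𝓝 x, w ∈ A) →
      (∀ x ∈ W, g x = g y → ∃ᶠ w in 𝓝 x, w ∈ B) → A ⊆ S → B ∩ S = ∅ →
      ((∀ x ∈ W, g x = g y → x ∈ C) ∧
      ∀ x ∈ W, g x = g y → (∃ᶠ w in 𝓝 x, w ∈ S ∧ w ∉ C) ∧ ∃ᶠ w in 𝓝 x, w ∉ S) := by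
    intro A B hAC hA hB hAS hBS
    have hBS' : ∀ x ∈ B, x ∉ S := fun x hx hxS => (hBS.subset ⟨hx, hxS⟩ : x ∈ (∅ : Set _))
    refine ⟨fun x hx hxy => ?_, fun x hx hxy =>
      ⟨(hA x hx hxy).mono fun w hw => ⟨hAS hw, disjoint_left.1 hAC hw⟩,
        (hB x hx hxy).mono hBS'⟩⟩
    by_contra hxC
    have hxS : x ∈ S := by
      by_contra hxS
      exact hA x hx hxy ((hS x hx hxS).mono fun w hw hwA => hw (hAS hwA))
    exact hB x hx hxy ((hSo x hx hxS hxC).mono fun w hw hwB => hBS' w hwB hw)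
  rcases key _ inter_subset_left hupC hpre with h1 | h1 <;>
    rcases key _ inter_subset_left hdownC hpre' with h2 | h2
  · refine Or.inl fun x hx => ?_
    rcases lt_trichotomy (g x) (g y) with h | h | h
    · exact h2 ⟨hx, h⟩
    · by_contra hxS
      exact hup' x hx h ((hS x hx hxS).mono fun w hw hwA => hw (h1 hwA))
    · exact h1 ⟨hx, h⟩
  · exact Or.inr (Or.inr (one _ _ hupC hup' hdown' h1 h2))
  · exact Or.inr (Or.inr (one _ _ hdownC hdown' hup' h2 h1))
  · refine Or.inr (Or.inl ?_)
    rintro x ⟨hx, hxS⟩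
    rcases lt_trichotomy (g x) (g y) with h | h | h
    · exact absurd (h2.subset ⟨⟨hx, h⟩, hxS⟩) (notMem_empty _)
    · by_contra hxC
      refine hup' x hx h ((hSo x hx hxS hxC).mono fun w hw hwA => ?_)
      exact absurd (h1.subset ⟨hwA, hw⟩) (notMem_empty _)
    · exact absurd (h1.subset ⟨⟨hx, h⟩, hxS⟩) (notMem_empty _)

/-- A linear form complementary to `D` that restricts to an isomorphism on a real plane along which
`D` is purely imaginary and nonzero. -/
lemma exists_linear_coordinate {D : (Fin 2 → ℂ) →L[ℂ] ℂ} {P : ℝ × ℝ →L[ℝ] (Fin 2 → ℂ)}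
    {G : ℝ × ℝ →L[ℝ] ℝ} (hP : Function.Injective P) (hDP : ∀ v, D (P v) = Complex.I * G v)
    (hG : G ≠ 0) : ∃ l : (Fin 2 → ℂ) →L[ℂ] ℂ, (∀ w, D w = 0 → l w = 0 → w = 0) ∧
      ∀ v, l (P v) = 0 → v = 0 := by
  obtain ⟨d, rfl⟩ := exists_eq_linForm D
  have hGv : ∀ v : ℝ × ℝ, G v = v.1 * G (1, 0) + v.2 * G (0, 1) := by
    intro v
    have : v = v.1 • ((1, 0) : ℝ × ℝ) + v.2 • ((0, 1) : ℝ × ℝ) := by ext <;> simp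
    conv_lhs => rw [this]
    rw [map_add, map_smul, map_smul, smul_eq_mul, smul_eq_mul]
  set p := G (1, 0) with hp
  set q := G (0, 1) with hq
  have hN : p ^ 2 + q ^ 2 ≠ 0 := by
    intro h
    have h1 : p = 0 := by nlinarith [sq_nonneg p, sq_nonneg q]
    have h2 : q = 0 := by nlinarith [sq_nonneg p, sq_nonneg q]
    exact hG (ContinuousLinearMap.ext fun v => by rw [hGv, h1, h2]; simp)
  have hd0 : d ≠ 0 := by
    rintro rfl
    refine hG (ContinuousLinearMap.ext fun v => ?_)
    have := hDP v
    simp only [linForm_apply, Pi.zero_apply, zero_mul, add_zero] at this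
    simpa using this.symm
  set L := linForm (conjForm d) with hL
  have hcomp : ∀ (η : ℂ) w, linForm d w = 0 → L w + η * linForm d w = 0 → w = 0 := by
    intro η w h1 h2
    rw [hL, linForm_apply, linForm_apply] at h2
    rw [linForm_apply] at h1
    obtain ⟨h3, h4⟩ := eq_of_forms_eq_zero hd0 h1 h2
    ext i; fin_cases i
    · exact h3
    · exact h4
  set v0 : ℝ × ℝ := (-q, p) with hv0
  set v1 : ℝ × ℝ := (p, q) with hv1
  have hGv0 : G v0 = 0 := by rw [hGv]; simp [hv0]; ring
  have hGv1 : G v1 = p ^ 2 + q ^ 2 := by rw [hGv]; simp [hv1]; ring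
  have hLv0 : L (P v0) ≠ 0 := by
    intro h
    have h1 := hcomp 0 (P v0) (by rw [hDP, hGv0]; simp) (by rw [h]; simp)
    have h2 : v0 = 0 := hP (by rw [h1, map_zero])
    have h3 : -q = 0 := congrArg Prod.fst h2
    have h4 : p = 0 := congrArg Prod.snd h2
    exact hN (by rw [h4, neg_eq_zero.1 h3]; simp)
  have hNc : ((p ^ 2 + q ^ 2 : ℝ) : ℂ) ≠ 0 := Complex.ofReal_ne_zero.2 hN
  set η : ℂ := (Complex.I * L (P v0) - L (P v1)) / (Complex.I * ((p ^ 2 + q ^ 2 : ℝ) : ℂ)) with hη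
  refine ⟨L + η • linForm d, fun w h1 h2 => hcomp η w h1 (by simpa using h2), fun v hv => ?_⟩
  set N := p ^ 2 + q ^ 2 with hNdef
  set a := (p * v.2 - q * v.1) / N with ha
  set b := (p * v.1 + q * v.2) / N with hb
  have hv' : v = a • v0 + b • v1 := by
    ext
    · simp only [hv0, hv1, Prod.fst_add, Prod.smul_fst, smul_eq_mul, ha, hb]
      field_simp
      rw [hNdef]; ring
    · simp only [hv0, hv1, Prod.snd_add, Prod.smul_snd, smul_eq_mul, ha, hb]
      field_simp
      rw [hNdef]; ring
  have e0 : L (P v0) + η * linForm d (P v0) = L (P v0) := by rw [hDP, hGv0]; simp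
  have e1 : L (P v1) + η * linForm d (P v1) = Complex.I * L (P v0) := by
    rw [hDP, hGv1, hη, div_mul_cancel₀ _ (mul_ne_zero Complex.I_ne_zero hNc)]
    ring
  have hv2 : L (P v) + η * linForm d (P v) = 0 := by simpa using hv
  have hPv : P v = (a : ℂ) • P v0 + (b : ℂ) • P v1 := by
    conv_lhs => rw [hv', map_add, map_smul, map_smul]
    rfl
  rw [hPv, map_add, map_add, map_smul, map_smul, map_smul, map_smul] at hv2
  simp only [smul_eq_mul] at hv2
  have h3 : ((a : ℂ) + b * Complex.I) * L (P v0) = 0 := by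
    linear_combination hv2 - (a : ℂ) * e0 - (b : ℂ) * e1
  have h4 := (mul_eq_zero.1 h3).resolve_right hLv0
  have h5 := congrArg Complex.re h4
  have h6 := congrArg Complex.im h4
  have h5' : a = 0 := by simpa using h5
  have h6' : b = 0 := by simpa using h6
  rw [hv', h5', h6']; simp

/-- A parametrization `σ` of a holomorphic curve near a point of a real surface, which agrees with
`φ` where `φ` meets the curve. -/
lemma exists_curve_parametrization {φ : ℝ × ℝ → (Fin 2 → ℂ)} {f : (Fin 2 → ℂ) → ℂ} {y : ℝ × ℝ}
    {D : (Fin 2 → ℂ) →L[ℂ] ℂ} {P : ℝ × ℝ →L[ℝ] (Fin 2 → ℂ)} {G : ℝ × ℝ →L[ℝ] ℝ}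
    (hφ : HasStrictFDerivAt φ P y) (hφc : ∀ᶠ x in 𝓝 y, ContinuousAt φ x)
    (hf : HasStrictFDerivAt f D (φ y)) (hP : Function.Injective P)
    (hDP : ∀ v, D (P v) = Complex.I * G v) (hG : G ≠ 0) :
    ∃ (σ : ℝ × ℝ → (Fin 2 → ℂ)) (τ : (Fin 2 → ℂ) → ℝ × ℝ),
      σ y = φ y ∧ (∀ᶠ x in 𝓝 y, ContinuousAt σ x) ∧
      (∀ᶠ x in 𝓝 y, f (σ x) = f (φ y)) ∧
      (∀ᶠ x in 𝓝 y, f (φ x) = f (φ y) → σ x = φ x) ∧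
      Tendsto τ (𝓝 (φ y)) (𝓝 y) ∧
      (∀ᶠ z in 𝓝 (φ y), f z = f (φ y) → σ (τ z) = z) ∧
      (∀ᶠ x in 𝓝 y, τ (φ x) = x) ∧ ∀ᶠ x in 𝓝 y, τ (σ x) = x := by
  obtain ⟨l, hDl, hlP⟩ := exists_linear_coordinate hP hDP hG
  obtain ⟨e, hxe, he⟩ := exists_openPartialHomeomorph_prodMk (𝕜 := ℂ) (by simp) hf
    (l.hasStrictFDerivAt (x := φ y)) hDl
  have hlφ : HasStrictFDerivAt (fun x => l (φ x)) ((l.restrictScalars ℝ).comp P) y :=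
    (l.restrictScalars ℝ).hasStrictFDerivAt.comp y hφ
  obtain ⟨A, hA⟩ := exists_equiv_eq_prod (𝕜 := ℝ) (E := ℝ × ℝ) (F := ℝ) (G := ℝ) (by simp)
    (D := Complex.reCLM.comp ((l.restrictScalars ℝ).comp P))
    (L := Complex.imCLM.comp ((l.restrictScalars ℝ).comp P))
    (fun v h1 h2 => hlP v (Complex.ext h1 h2))
  obtain ⟨k, hyk, hk⟩ : ∃ k : OpenPartialHomeomorph (ℝ × ℝ) ℂ, y ∈ k.source ∧
      ∀ x, k x = l (φ x) := by
    have h : HasStrictFDerivAt (fun x => l (φ x))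
        ((A.trans Complex.equivRealProdCLM.symm : (ℝ × ℝ) ≃L[ℝ] ℂ) : ℝ × ℝ →L[ℝ] ℂ) y := by
      refine hlφ.congr_fderiv (ContinuousLinearMap.ext fun v => ?_)
      have : A v = (Complex.re (l (P v)), Complex.im (l (P v))) := DFunLike.congr_fun hA v
      simp only [ContinuousLinearMap.comp_apply, ContinuousLinearEquiv.coe_coe,
        ContinuousLinearEquiv.trans_apply, this]
      exact (Complex.equivRealProdCLM.symm_apply_apply (l (P v))).symm
    exact ⟨h.toOpenPartialHomeomorph _, h.mem_toOpenPartialHomeomorph_source, fun x => rfl⟩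
  set c := f (φ y)
  have hφy : ContinuousAt φ y := hφ.continuousAt
  have hely : e (φ y) = (c, l (φ y)) := he _
  have htgt0 : (c, l (φ y)) ∈ e.target := hely ▸ e.map_source hxe
  have hincc : ContinuousAt (fun x => (c, l (φ x))) y := by fun_prop
  have hinc : ∀ᶠ x in 𝓝 y, (c, l (φ x)) ∈ e.target :=
    hincc.eventually (e.open_target.mem_nhds htgt0)
  have hσy : e.symm (c, l (φ y)) = φ y := by rw [← hely, e.left_inv hxe]
  have hfl : ∀ᶠ x in 𝓝 y, f (e.symm (c, l (φ x))) = c ∧ l (e.symm (c, l (φ x))) = l (φ x) := by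
    filter_upwards [hinc] with x hx
    have := e.right_inv hx
    rw [he, Prod.mk.injEq] at this
    exact this
  have hky : k y = l (φ y) := hk y
  have hktgt : l (φ y) ∈ k.target := hky ▸ k.map_source hyk
  have hτ : Tendsto (fun z => k.symm (l z)) (𝓝 (φ y)) (𝓝 y) := by
    have h1 := (k.continuousAt_symm (k.map_source hyk)).tendsto
    rw [k.left_inv hyk, hky] at h1
    exact h1.comp (l.continuous.tendsto _)
  have hkl : ∀ᶠ x in 𝓝 y, k.symm (l (φ x)) = x := by
    filter_upwards [k.open_source.mem_nhds hyk] with x hx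
    rw [← hk, k.left_inv hx]
  refine ⟨fun x => e.symm (c, l (φ x)), fun z => k.symm (l z), hσy, ?_,
    hfl.mono fun x hx => hx.1, ?_, hτ, ?_, hkl, ?_⟩
  · filter_upwards [hinc, hφc] with x hx hcx
    have h2 : ContinuousAt (fun x => (c, l (φ x))) x := by fun_prop
    exact ContinuousAt.comp (g := e.symm) (e.continuousAt_symm hx) h2
  · filter_upwards [hφy.eventually (e.open_source.mem_nhds hxe)] with x hx hfx
    rw [← hfx, ← he, e.left_inv hx]
  · filter_upwards [e.open_source.mem_nhds hxe,
      (l.continuous.tendsto (φ y)).eventually (k.open_target.mem_nhds hktgt)] with z hz hzk hfz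
    rw [← hk, k.right_inv hzk, ← hfz, ← he, e.left_inv hz]
  · filter_upwards [hfl, hkl] with x hx hx2
    rw [hx.2, hx2]

lemma eventually_fderiv_ne_zero {𝕜 E F : Type*} [RCLike 𝕜] [NormedAddCommGroup E]
    [NormedSpace 𝕜 E] [NormedAddCommGroup F] [NormedSpace 𝕜 F] {f : E → F} {x : E}
    (hf : ContDiffAt 𝕜 1 f x) (hx : fderiv 𝕜 f x ≠ 0) : ∀ᶠ y in 𝓝 x, fderiv 𝕜 f y ≠ 0 :=
  (hf.fderiv_right (m := 0) (by simp)).continuousAt.eventually (isOpen_ne.mem_nhds hx)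

section LevelSet

variable {Ω : Set (Fin 2 → ℂ)} {U : Set (ℝ × ℝ)} {φ : ℝ × ℝ → (Fin 2 → ℂ)}
  {f : (Fin 2 → ℂ) → ℂ} {g : ℝ × ℝ → ℝ} {t : ℝ} {c : ℂ} {C : Set (ℝ × ℝ)}

/-- Local structure of the hull of a level set near one of its points. -/
lemma levelSet_local_structure (hΩ : IsOpen Ω)
    (hf : ∀ z ∈ Ω, ContDiffAt ℂ 1 f z) {y : ℝ × ℝ} (hφ : ∀ᶠ x in 𝓝 y, ContDiffAt ℝ 1 φ x)
    (hg : ContDiffAt ℝ 1 g y) (hC : IsCompact C) (hφC : ContinuousOn φ C) (hinj : InjOn φ C)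
    (hyΩ : φ y ∈ Ω) (hP : Function.Injective (fderiv ℝ φ y))
    (hDP : ∀ v, fderiv ℂ f (φ y) (fderiv ℝ φ y v) = Complex.I * fderiv ℝ g y v)
    (hdg : fderiv ℝ g y ≠ 0) (hyC : y ∈ C) (hCt : ∀ x ∈ C, g x = t)
    (hCc : ∀ x ∈ C, f (φ x) = c)
    (hgen : PolyGeneric (φ '' C))
    (hX : ∀ z ∈ polyHull 2 (φ '' C), z ∈ Ω → f z = c) :
    (¬ ∀ᶠ z in 𝓝 (φ y), f z = c → z ∈ φ '' C) ∧
    ((∀ᶠ z in 𝓝 (φ y), f z = c → z ∈ polyHull 2 (φ '' C)) ∨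
      (∀ᶠ z in 𝓝 (φ y), z ∈ polyHull 2 (φ '' C) → z ∈ φ '' C) ∨
      ∀ᶠ x in 𝓝 y, g x = t → x ∈ C ∧
        (¬ ∀ᶠ z in 𝓝 (φ x), f z = c → z ∈ polyHull 2 (φ '' C)) ∧
        ¬ ∀ᶠ z in 𝓝 (φ x), z ∈ polyHull 2 (φ '' C) → z ∈ φ '' C) := by
  have hE : IsCompact (φ '' C) := hC.image_of_continuousOn hφC
  have hφy : ContDiffAt ℝ 1 φ y := hφ.self_of_nhds
  have hfy := hf _ hyΩ
  have hfcy : f (φ y) = c := hCc y hyC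
  have hDf : fderiv ℂ f (φ y) ≠ 0 := by
    intro h
    refine hdg (ContinuousLinearMap.ext fun v => ?_)
    have := hDP v
    rw [h] at this
    simpa using this.symm
  obtain ⟨σ, τ, hσy, hσc, hfσ, hσφ, hτ, hστ, hτφ, hτσ⟩ :=
    exists_curve_parametrization (hφy.hasStrictFDerivAt one_ne_zero)
      (hφ.mono fun x hx => hx.continuousAt) (hfy.hasStrictFDerivAt one_ne_zero) hP hDP hdg
  rw [hfcy] at hfσ hσφ hστ
  have hσcy : Tendsto σ (𝓝 y) (𝓝 (φ y)) := by
    have := hσc.self_of_nhds.tendsto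
    rwa [hσy] at this
  have hnear : ∀ᶠ z in 𝓝 (φ y), z ∈ φ '' C → τ z ∈ C := by
    have hK : IsCompact (φ '' (C \ interior {x | τ (φ x) = x})) :=
      (hC.diff isOpen_interior).image_of_continuousOn (hφC.mono sdiff_subset)
    have hyK : φ y ∉ φ '' (C \ interior {x | τ (φ x) = x}) := by
      rintro ⟨x, ⟨hxC, hx⟩, hxy⟩
      rw [hinj hxC hyC hxy] at hx
      exact hx (mem_interior_iff_mem_nhds.2 hτφ)
    filter_upwards [hK.isClosed.isOpen_compl.mem_nhds hyK]
    rintro _ hz ⟨x, hx, rfl⟩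
    have h1 : x ∈ interior {x | τ (φ x) = x} := by
      by_contra h
      exact hz ⟨x, ⟨hx, h⟩, rfl⟩
    have h2 : x ∈ {x | τ (φ x) = x} := interior_subset h1
    rw [mem_ofPred_eq] at h2
    rwa [h2]
  have hσE : ∀ᶠ x in 𝓝 y, σ x ∈ φ '' C → x ∈ C := by
    filter_upwards [hσcy.eventually hnear, hτσ] with x hx hx2 hxE
    rw [← hx2]; exact hx hxE
  refine ⟨fun hthin => ?_, ?_⟩
  · refine frequently_lt_of_fderiv_ne_zero hdg ?_
    filter_upwards [hσcy.eventually hthin, hfσ, hσE] with x h1 h2 h3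
    rw [hCt y hyC, hCt x (h3 (h1 h2))]
    exact lt_irrefl t
  set X := polyHull 2 (φ '' C)
  have hσΩ : ∀ᶠ x in 𝓝 y, σ x ∈ Ω := hσcy.eventually (hΩ.mem_nhds hyΩ)
  have hσD : ∀ᶠ x in 𝓝 y, fderiv ℂ f (σ x) ≠ 0 :=
    hσcy.eventually (eventually_fderiv_ne_zero hfy hDf)
  have hσφ' : ∀ᶠ x in 𝓝 y, x ∈ C → σ x = φ x := by
    filter_upwards [hσφ] with x hx hxC using hx (hCc x hxC)
  obtain ⟨W, hWo, hyW, hWN, hpre, hpre'⟩ := exists_open_preconnected_sides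
    (hg.hasStrictFDerivAt one_ne_zero) hdg (hσc.and (hfσ.and (hσφ'.and (hσE.and (hσΩ.and
      (hσD.and (eventually_fderiv_ne_zero hg hdg)))))))
  have hWn : ∀ x ∈ W, ∀ᶠ w in 𝓝 x, w ∈ W := fun x hx => hWo.mem_nhds hx
  rcases sides_trichotomy (C := C) (S := {x | σ x ∈ X}) hWo
    (fun x hx => frequently_gt_of_fderiv_ne_zero (hWN hx).2.2.2.2.2.2)
    (fun x hx => frequently_lt_of_fderiv_ne_zero (hWN hx).2.2.2.2.2.2) hpre hpre'
    (fun x hx hxS => (hWN hx).1.eventually (isClosed_polyHull.isOpen_compl.mem_nhds hxS))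
    (fun x hx hxS hxC => by
      obtain ⟨h1, h2, h3, h4, h5, h6, -⟩ := hWN hx
      have h7 := eventually_mem_polyHull_of_eq hE hgen hΩ h5 hxS (fun h => hxC (h4 h))
        (fun z hz hzΩ => (hX z hz hzΩ).trans h2.symm)
        ((hf _ h5).hasStrictFDerivAt one_ne_zero) h6
      filter_upwards [h1.eventually h7, hWn x hx] with w hw hwW
      exact hw ((hWN hwW).2.1.trans h2.symm))
    (fun x hx => (hCt x hx).trans (hCt y hyC).symm) with h | h | h
  · refine Or.inl ?_
    filter_upwards [hτ.eventually (hWn y hyW), hστ] with z hz1 hz2 hz3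
    have h1 : σ (τ z) ∈ X := h hz1
    rwa [hz2 hz3] at h1
  · refine Or.inr (Or.inl ?_)
    filter_upwards [hτ.eventually (hWn y hyW), hστ, hΩ.mem_nhds hyΩ] with z hz1 hz2 hz3 hzX
    have h1 := hz2 (hX z hzX hz3)
    have h2 : τ z ∈ C := h ⟨hz1, show σ (τ z) ∈ X by rwa [h1]⟩
    refine ⟨τ z, h2, ?_⟩
    rw [← (hWN hz1).2.2.1 h2, h1]
  · refine Or.inr (Or.inr ?_)
    filter_upwards [hWn y hyW] with x hx hxt
    have hxy : g x = g y := hxt.trans (hCt y hyC).symm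
    have hxC := h.1 x hx hxy
    obtain ⟨hf1, hf2⟩ := h.2 x hx hxy
    obtain ⟨h1, h2, h3, -⟩ := hWN hx
    have hσx : Tendsto σ (𝓝 x) (𝓝 (φ x)) := by
      rw [← h3 hxC]; exact h1
    refine ⟨hxC, fun hfull => hf2 ?_, fun hnone => hf1 ?_⟩
    · filter_upwards [hσx.eventually hfull, hWn x hx] with w hw hwW hwS
      exact hwS (hw (hWN hwW).2.1)
    · filter_upwards [hσx.eventually hnone, hWn x hx] with w hw hwW hwS
      exact hwS.2 ((hWN hwW).2.2.2.1 (hw hwS.1))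

/-- Level sets on a totally real disc have trivial hull. -/
theorem polyHull_levelSet_subset (hΩ : IsOpen Ω) (hU : IsOpen U)
    (hQU : Metric.closedBall 0 1 ⊆ U) (hf : ∀ z ∈ Ω, ContDiffAt ℂ 1 f z)
    (hφ : ∀ x ∈ U, ContDiffAt ℝ 1 φ x) (hg : ∀ x ∈ U, ContDiffAt ℝ 1 g x)
    (hinj : InjOn φ (Metric.closedBall 0 1)) (hQΩ : ∀ y ∈ Metric.closedBall 0 1, φ y ∈ Ω)
    (hP : ∀ y ∈ Metric.closedBall (0 : ℝ × ℝ) 1, Function.Injective (fderiv ℝ φ y))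
    (hDP : ∀ y ∈ Metric.closedBall 0 1, ∀ v,
      fderiv ℂ f (φ y) (fderiv ℝ φ y v) = Complex.I * fderiv ℝ g y v)
    (hdg : ∀ y ∈ Metric.closedBall (0 : ℝ × ℝ) 1, fderiv ℝ g y ≠ 0)
    (hCdef : C = {y | y ∈ Metric.closedBall 0 1 ∧ g y = t})
    (hCc : ∀ x ∈ C, f (φ x) = c)
    (hX : ∀ z ∈ polyHull 2 (φ '' C), z ∈ Ω → f z = c) :
    polyHull 2 (φ '' C) ⊆ φ '' C := by
  have hCQ : C ⊆ Metric.closedBall 0 1 := fun y hy => (hCdef ▸ hy :).1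
  have hCt : ∀ y ∈ C, g y = t := fun y hy => (hCdef ▸ hy :).2
  have hgQ : ContinuousOn g U := fun x hx => (hg x hx).continuousAt.continuousWithinAt
  have hφQ : ContinuousOn φ U := fun x hx => (hφ x hx).continuousAt.continuousWithinAt
  have hC : IsCompact C := by
    rw [hCdef]
    exact (isCompact_closedBall _ _).of_isClosed_subset
      ((hgQ.mono hQU).preimage_isClosed_of_isClosed Metric.isClosed_closedBall
        (isClosed_singleton (x := t))) inter_subset_left
  have hφC : ContinuousOn φ C := hφQ.mono (hCQ.trans hQU)
  have hgen : PolyGeneric (φ '' C) := by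
    intro u v huv ε hε
    have hd : ∀ (p : MvPolynomial (Fin 2) ℂ), ∀ y ∈ Metric.closedBall (0 : ℝ × ℝ) 1,
        DifferentiableAt ℝ (fun y => MvPolynomial.eval (φ y) p) y := by
      intro p y hy
      have h1 : DifferentiableAt ℂ (fun z => MvPolynomial.eval z p) (φ y) :=
        (AnalyticOnNhd.eval_mvPolynomial p (φ y) (mem_univ _)).differentiableAt
      exact (h1.restrictScalars ℝ).comp y ((hφ y (hQU hy)).differentiableAt one_ne_zero)
    obtain ⟨η, hη, h⟩ := exists_add_mul_ne_zero_on_levelSet (Q := Metric.closedBall 0 1) (t := t)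
      (fun y hy => (hg y (hQU hy)).differentiableAt one_ne_zero) hdg (hd u) (hd v)
      (fun y hy hyt hu => huv _ ⟨y, hCdef ▸ ⟨hy, hyt⟩, rfl⟩ hu) hε
    refine ⟨η, hη, ?_⟩
    rintro _ ⟨y, hy, rfl⟩
    exact h y (hCQ hy) (hCt y hy)
  have hloc := fun y (hy : y ∈ C) => levelSet_local_structure hΩ hf
    ((hU.eventually_mem (hQU (hCQ hy))).mono fun x hx => hφ x hx) (hg y (hQU (hCQ hy))) hC hφC
    (hinj.mono hCQ) (hQΩ y (hCQ hy)) (hP y (hCQ hy)) (hDP y (hCQ hy)) (hdg y (hCQ hy)) hy hCt hCc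
    hgen hX
  set X := polyHull 2 (φ '' C)
  set C₁ : Set (ℝ × ℝ) := {x | x ∈ C ∧ (¬ ∀ᶠ z in 𝓝 (φ x), f z = c → z ∈ X) ∧
        ¬ ∀ᶠ z in 𝓝 (φ x), z ∈ X → z ∈ φ '' C} with hC₁
  have hC₁c : IsCompact C₁ := by
    have h1 : C₁ = C ∩ φ ⁻¹' ({z | ∀ᶠ w in 𝓝 z, f w = c → w ∈ X} ∪
        {z | ∀ᶠ w in 𝓝 z, w ∈ X → w ∈ φ '' C})ᶜ := by
      ext x
      simp only [hC₁, mem_ofPred_eq, mem_inter_iff, mem_preimage, mem_compl_iff, mem_union, not_or]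
    rw [h1]
    refine hC.of_isClosed_subset (hφC.preimage_isClosed_of_isClosed hC.isClosed ?_)
      inter_subset_left
    exact (isOpen_setOfPred_eventually_nhds.union isOpen_setOfPred_eventually_nhds).isClosed_compl
  have hempty : C₁ = ∅ := by
    refine eq_empty_of_relativelyOpen_levelSet hU hQU hgQ hdg hC₁c (fun y hy => hCQ hy.1)
      (fun y hy => hCt y hy.1) fun y hy => ?_
    rcases (hloc y hy.1).2 with h | h | h
    · exact absurd h hy.2.1
    · exact absurd h hy.2.2
    · exact h
  refine polyHull_subset_of_dichotomy (Ω := Ω) (f := f) (c := c) (hC.image_of_continuousOn hφC) hgen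
    ?_ hf ?_ ?_ ?_ ?_
  · rintro _ ⟨y, hy, rfl⟩; exact hQΩ y (hCQ hy)
  · rintro _ ⟨y, hy, rfl⟩; exact hCc y hy
  · rintro _ ⟨y, hy, rfl⟩ h
    refine hdg y (hCQ hy) (ContinuousLinearMap.ext fun v => ?_)
    have := hDP y (hCQ hy) v
    rw [h] at this
    simpa using this.symm
  · rintro _ ⟨y, hy, rfl⟩; exact (hloc y hy).1
  · rintro _ ⟨y, hy, rfl⟩
    by_contra hcon
    exact (hempty.subset ⟨hy, not_or.1 hcon⟩ : y ∈ (∅ : Set _))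

end LevelSet

section Approximation

variable {n : ℕ}

/-- Functions that are uniform limits of polynomials on `L`. -/
def PolyApprox (L : Set (Fin n → ℂ)) (F : (Fin n → ℂ) → ℂ) : Prop :=
  ∀ ε > 0, ∃ p : MvPolynomial (Fin n) ℂ, ∀ x ∈ L, ‖F x - MvPolynomial.eval x p‖ ≤ ε

variable {K L : Set (Fin n → ℂ)} {F G : (Fin n → ℂ) → ℂ}

lemma polyApprox_eval (p : MvPolynomial (Fin n) ℂ) :
    PolyApprox L fun x => MvPolynomial.eval x p :=
  fun ε hε => ⟨p, fun x _ => by simpa using hε.le⟩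

lemma PolyApprox.add (hF : PolyApprox L F) (hG : PolyApprox L G) :
    PolyApprox L fun x => F x + G x := by
  intro ε hε
  obtain ⟨p, hp⟩ := hF (ε / 2) (by positivity)
  obtain ⟨q, hq⟩ := hG (ε / 2) (by positivity)
  refine ⟨p + q, fun x hx => ?_⟩
  have : F x + G x - MvPolynomial.eval x (p + q) =
      (F x - MvPolynomial.eval x p) + (G x - MvPolynomial.eval x q) := by simp; ring
  rw [this]
  linarith [norm_add_le (F x - MvPolynomial.eval x p) (G x - MvPolynomial.eval x q), hp x hx,
    hq x hx]

lemma PolyApprox.exists_bound (hL : IsCompact L) (hF : PolyApprox L F) :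
    ∃ B, 0 < B ∧ ∀ x ∈ L, ‖F x‖ ≤ B := by
  obtain ⟨p, hp⟩ := hF 1 one_pos
  obtain ⟨B, hB⟩ := hL.exists_bound_of_continuousOn (MvPolynomial.continuous_eval p).continuousOn
  refine ⟨|B| + 1, by positivity, fun x hx => ?_⟩
  have : F x = (F x - MvPolynomial.eval x p) + MvPolynomial.eval x p := by ring
  rw [this]
  refine (norm_add_le _ _).trans ?_
  linarith [hp x hx, hB x hx, le_abs_self B]

lemma PolyApprox.mul (hL : IsCompact L) (hF : PolyApprox L F) (hG : PolyApprox L G) :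
    PolyApprox L fun x => F x * G x := by
  intro ε hε
  obtain ⟨A, hA0, hA⟩ := hF.exists_bound hL
  obtain ⟨B, hB0, hB⟩ := hG.exists_bound hL
  set δ := min 1 (ε / (A + B + 1)) with hδ
  have hδ0 : 0 < δ := lt_min one_pos (by positivity)
  have hδ1 : δ ≤ 1 := min_le_left _ _
  have hδε : δ * (A + B + 1) ≤ ε := by
    rw [← le_div_iff₀ (by positivity)]; exact min_le_right _ _
  obtain ⟨p, hp⟩ := hF δ hδ0
  obtain ⟨q, hq⟩ := hG δ hδ0
  refine ⟨p * q, fun x hx => ?_⟩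
  have h1 : F x * G x - MvPolynomial.eval x (p * q) =
      F x * (G x - MvPolynomial.eval x q) + (F x - MvPolynomial.eval x p) * G x -
        (F x - MvPolynomial.eval x p) * (G x - MvPolynomial.eval x q) := by simp; ring
  rw [h1]
  calc _ ≤ ‖F x‖ * ‖G x - MvPolynomial.eval x q‖ + ‖F x - MvPolynomial.eval x p‖ * ‖G x‖ +
        ‖F x - MvPolynomial.eval x p‖ * ‖G x - MvPolynomial.eval x q‖ := by
        refine (norm_sub_le _ _).trans (add_le_add ((norm_add_le _ _).trans ?_) ?_) <;>
          simp only [norm_mul, le_refl]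
    _ ≤ A * δ + δ * B + δ * 1 := by
        gcongr
        · exact hA x hx
        · exact hq x hx
        · exact hp x hx
        · exact hB x hx
        · exact hp x hx
        · exact (hq x hx).trans hδ1
    _ ≤ ε := by linarith

lemma PolyApprox.pow (hL : IsCompact L) (hF : PolyApprox L F) (m : ℕ) :
    PolyApprox L fun x => F x ^ m := by
  induction m with
  | zero =>
    have := polyApprox_eval (L := L) (1 : MvPolynomial (Fin n) ℂ)
    simpa using this
  | succ m ih => simpa only [pow_succ] using ih.mul hL hF

lemma PolyApprox.norm_le (hK : IsCompact K) {z : Fin n → ℂ} (hz : z ∈ polyHull n K)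
    (hF : PolyApprox (insert z K) F) {C : ℝ} (hC : ∀ k ∈ K, ‖F k‖ ≤ C) : ‖F z‖ ≤ C := by
  refine le_of_forall_pos_le_add fun ε hε => ?_
  obtain ⟨p, hp⟩ := hF (ε / 2) (by positivity)
  have h1 : ‖MvPolynomial.eval z p‖ ≤ C + ε / 2 := by
    refine (mem_polyHull_iff hK).1 hz p _ fun k hk => ?_
    have h := norm_sub_norm_le (MvPolynomial.eval k p) (F k)
    rw [norm_sub_rev] at h
    linarith [hC k hk, hp k (mem_insert_of_mem _ hk)]
  linarith [norm_sub_norm_le (F z) (MvPolynomial.eval z p), hp z (mem_insert _ _)]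

/-- A uniform limit of polynomials on `K` extends to each point of the hull. -/
lemma PolyApprox.exists_extension (hK : IsCompact K) {z : Fin n → ℂ} (hz : z ∈ polyHull n K)
    (hF : PolyApprox K F) :
    ∃ G : (Fin n → ℂ) → ℂ, (∀ k ∈ K, G k = F k) ∧ PolyApprox (insert z K) G := by
  classical
  choose p hp using fun j : ℕ => hF (1 / ((j : ℝ) + 1)) (by positivity)
  have hlim : Tendsto (fun j : ℕ => 1 / ((j : ℝ) + 1)) atTop (𝓝 0) :=
    tendsto_one_div_add_atTop_nhds_zero_nat
  have hdiff : ∀ i j, ‖MvPolynomial.eval z (p i) - MvPolynomial.eval z (p j)‖ ≤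
      1 / ((i : ℝ) + 1) + 1 / ((j : ℝ) + 1) := by
    intro i j
    rw [← map_sub]
    refine (mem_polyHull_iff hK).1 hz _ _ fun k hk => ?_
    have h1 := norm_sub_le (F k - MvPolynomial.eval k (p j)) (F k - MvPolynomial.eval k (p i))
    rw [sub_sub_sub_cancel_left] at h1
    rw [map_sub]
    linarith [hp i k hk, hp j k hk]
  have hcau : CauchySeq fun j => MvPolynomial.eval z (p j) := by
    refine cauchySeq_of_le_tendsto_0 (fun N : ℕ => 1 / ((N : ℝ) + 1) + 1 / ((N : ℝ) + 1))
      (fun i j N hi hj => ?_) (by simpa using hlim.add hlim)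
    rw [dist_eq_norm]
    refine (hdiff i j).trans (add_le_add ?_ ?_) <;> gcongr
  obtain ⟨w, hw⟩ := cauchySeq_tendsto_of_complete hcau
  have hwz : z ∈ K → w = F z := by
    intro hzK
    refine tendsto_nhds_unique hw (tendsto_iff_norm_sub_tendsto_zero.2 ?_)
    refine squeeze_zero (fun _ => norm_nonneg _) (fun j => ?_) hlim
    rw [norm_sub_rev]; exact hp j z hzK
  refine ⟨fun x => if x = z then w else F x, fun k hk => ?_, fun ε hε => ?_⟩
  · by_cases h : k = z
    · subst h; simp [hwz hk]
    · simp [h]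
  · have hw' := tendsto_iff_norm_sub_tendsto_zero.1 hw
    obtain ⟨j, hj1, hj2⟩ := ((hlim.eventually (eventually_le_nhds hε)).and
      (hw'.eventually (eventually_le_nhds hε))).exists
    refine ⟨p j, fun x hx => ?_⟩
    change ‖(if x = z then w else F x) - MvPolynomial.eval x (p j)‖ ≤ ε
    by_cases h : x = z
    · subst h
      rw [if_pos rfl, norm_sub_rev]; exact hj2
    · rw [if_neg h]
      exact (hp j x (hx.resolve_left h)).trans hj1

/-- The hull of `K` is the union of the hulls of the fibres of a purely imaginary function that is
a uniform limit of polynomials. -/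
lemma exists_mem_polyHull_fiber (hK : IsCompact K) (hFc : ContinuousOn F K)
    (hre : ∀ k ∈ K, (F k).re = 0) (hF : PolyApprox K F) {z : Fin n → ℂ}
    (hz : z ∈ polyHull n K) :
    ∃ b : ℝ, z ∈ polyHull n {k | k ∈ K ∧ F k = b * Complex.I} := by
  obtain ⟨G, hGF, hG⟩ := hF.exists_extension hK hz
  have hL : IsCompact (insert z K) := hK.insert z
  obtain ⟨R, hR0, hR⟩ := hG.exists_bound hL
  have hGre : ∀ k ∈ K, (G k).re = 0 := fun k hk => by rw [hGF k hk]; exact hre k hk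
  have hconst : ∀ a : ℂ, PolyApprox (insert z K) fun _ => a := fun a => by
    simpa using polyApprox_eval (L := insert z K) (MvPolynomial.C a)
  have hzre : (G z).re = 0 := by
    by_contra hne
    have h : ∀ a : ℝ, ((G z).re - a) ^ 2 ≤ R ^ 2 + a ^ 2 := by
      intro a
      have h1 := (hG.add (hconst (-a))).norm_le hK hz (C := √(R ^ 2 + a ^ 2)) (fun k hk => by
        refine Real.le_sqrt_of_sq_le ?_
        rw [← Complex.normSq_eq_norm_sq, Complex.normSq_apply]
        have h2 := hR k (mem_insert_of_mem _ hk)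
        have h3 := (Complex.abs_im_le_norm (G k)).trans h2
        have h4 := sq_le_sq' (abs_le.1 h3).1 (abs_le.1 h3).2
        simp only [Complex.add_re, Complex.add_im, Complex.neg_re, Complex.neg_im,
          Complex.ofReal_re, Complex.ofReal_im, hGre k hk]
        linarith)
      have h5 := (Complex.abs_re_le_norm _).trans h1
      have h6 := sq_le_sq' (abs_le.1 h5).1 (abs_le.1 h5).2
      rw [Real.sq_sqrt (by positivity)] at h6
      simpa [sub_eq_add_neg] using h6
    have h1 := h (-(R ^ 2 + 1) / (2 * (G z).re))
    have h2 : (-(R ^ 2 + 1) / (2 * (G z).re)) * (G z).re = -(R ^ 2 + 1) / 2 := by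
      field_simp
    nlinarith [sq_nonneg (G z).re]
  have hGim : ∀ x ∈ insert z K, G x = (G x).im * Complex.I := by
    intro x hx
    apply Complex.ext
    · rcases hx with rfl | hx
      · simpa using hzre
      · simpa using hGre x hx
    · simp
  set b := (G z).im with hb
  set δ := 1 / (4 * R ^ 2) with hδ
  have hδ0 : 0 < δ := by positivity
  set H : (Fin n → ℂ) → ℂ := fun x => 1 + δ * (G x + -(b * Complex.I)) ^ 2 with hH
  have hHa : PolyApprox (insert z K) H :=
    (hconst 1).add ((hconst δ).mul hL ((hG.add (hconst _)).pow hL 2))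
  have hHval : ∀ x ∈ insert z K, H x = ((1 - δ * ((G x).im - b) ^ 2 : ℝ) : ℂ) := by
    intro x hx
    rw [hH]
    simp only
    rw [hGim x hx]
    push_cast
    simp only [Complex.mul_I_im, Complex.ofReal_re]
    linear_combination (δ : ℂ) * (((G x).im : ℂ) - b) ^ 2 * Complex.I_sq
  have hHnorm : ∀ x ∈ insert z K, ‖H x‖ = 1 - δ * ((G x).im - b) ^ 2 := by
    intro x hx
    rw [hHval x hx, Complex.norm_real, Real.norm_of_nonneg]
    have h1 := abs_le.1 ((Complex.abs_im_le_norm (G x)).trans (hR x hx))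
    have h2 := abs_le.1 ((Complex.abs_im_le_norm (G z)).trans (hR z (mem_insert _ _)))
    have h3 : ((G x).im - b) ^ 2 ≤ 4 * R ^ 2 := by
      have : (2 * R) ^ 2 = 4 * R ^ 2 := by ring
      rw [← this]
      exact sq_le_sq' (by linarith [h1.1, h2.2]) (by linarith [h1.2, h2.1])
    have h4 : δ * ((G x).im - b) ^ 2 ≤ 1 := by
      rw [hδ, div_mul_eq_mul_div, one_mul, div_le_one (by positivity)]; exact h3
    linarith
  have hHle : ∀ x ∈ insert z K, ‖H x‖ ≤ 1 := fun x hx => by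
    rw [hHnorm x hx]; nlinarith [sq_nonneg ((G x).im - b)]
  have hHlt : ∀ k ∈ K, F k ≠ b * Complex.I → ‖H k‖ < 1 := by
    intro k hk hne
    have hx := mem_insert_of_mem z hk
    rw [hHnorm k hx]
    have : (G k).im - b ≠ 0 := by
      intro h
      refine hne ?_
      rw [← hGF k hk, hGim k hx, sub_eq_zero.1 h]
    have := mul_pos hδ0 (sq_pos_of_ne_zero this)
    linarith
  have hHz : ‖H z‖ = 1 := by rw [hHnorm z (mem_insert _ _)]; simp [hb]
  have hHc : ContinuousOn (fun k => ‖H k‖) K := by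
    have hGc : ContinuousOn G K := hFc.congr hGF
    fun_prop
  set T := {k | k ∈ K ∧ F k = b * Complex.I} with hT
  have hTc : IsCompact T := hK.of_isClosed_subset
    (hFc.preimage_isClosed_of_isClosed hK.isClosed (isClosed_singleton (x := (b * Complex.I : ℂ))))
    inter_subset_left
  have main : ∀ (q : MvPolynomial (Fin n) ℂ) (C : ℝ), 0 ≤ C →
      (∀ k ∈ T, ‖MvPolynomial.eval k q‖ ≤ C) → ‖MvPolynomial.eval z q‖ ≤ C := by
    intro q C hC0 hC
    refine le_of_forall_pos_le_add fun ε hε => ?_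
    have hqc : Continuous fun k => ‖MvPolynomial.eval k q‖ :=
      (MvPolynomial.continuous_eval q).norm
    have hV : IsCompact (K ∩ {k | C + ε ≤ ‖MvPolynomial.eval k q‖}) :=
      hK.inter_right (isClosed_le continuous_const hqc)
    obtain ⟨m, hm⟩ : ∃ m : ℕ, ∀ k ∈ K, ‖H k ^ m * MvPolynomial.eval k q‖ ≤ C + ε := by
      have hsmall : ∀ (m : ℕ), ∀ k ∈ K, ‖MvPolynomial.eval k q‖ ≤ C + ε →
          ‖H k ^ m * MvPolynomial.eval k q‖ ≤ C + ε := by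
        intro m k hk h
        rw [norm_mul, norm_pow]
        refine le_trans (mul_le_of_le_one_left (norm_nonneg _) ?_) h
        exact pow_le_one₀ (norm_nonneg _) (hHle k (mem_insert_of_mem _ hk))
      rcases (K ∩ {k | C + ε ≤ ‖MvPolynomial.eval k q‖}).eq_empty_or_nonempty with h | h
      · refine ⟨0, fun k hk => hsmall 0 k hk ?_⟩
        by_contra hcon
        exact (h.subset ⟨hk, (not_le.1 hcon).le⟩ : k ∈ (∅ : Set _))
      · obtain ⟨k₀, ⟨hk₀, hk₀q⟩, hmax⟩ := hV.exists_isMaxOn h (hHc.mono inter_subset_left)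
        have hlt : ‖H k₀‖ < 1 := by
          refine hHlt k₀ hk₀ fun h => ?_
          have h1 := hC k₀ ⟨hk₀, h⟩
          have h2 : C + ε ≤ ‖MvPolynomial.eval k₀ q‖ := hk₀q
          linarith
        obtain ⟨B, hB⟩ := hK.exists_bound_of_continuousOn
          (MvPolynomial.continuous_eval q).continuousOn
        have hB0 : 0 ≤ B := (norm_nonneg _).trans (hB k₀ hk₀)
        obtain ⟨m, hm⟩ := exists_pow_lt_of_lt_one (show 0 < (C + ε) / (B + 1) by positivity) hlt
        refine ⟨m, fun k hk => ?_⟩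
        by_cases hkq : C + ε ≤ ‖MvPolynomial.eval k q‖
        · rw [norm_mul, norm_pow]
          have h1 : ‖H k‖ ≤ ‖H k₀‖ := hmax ⟨hk, hkq⟩
          calc ‖H k‖ ^ m * ‖MvPolynomial.eval k q‖ ≤ (C + ε) / (B + 1) * (B + 1) := by
                gcongr
                · exact (pow_le_pow_left₀ (norm_nonneg _) h1 m).trans hm.le
                · linarith [hB k hk]
            _ = C + ε := div_mul_cancel₀ _ (by positivity)
        · exact hsmall m k hk (not_le.1 hkq).le
    have h := ((hHa.pow hL m).mul hL (polyApprox_eval q)).norm_le hK hz hm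
    rwa [norm_mul, norm_pow, hHz, one_pow, one_mul] at h
  refine ⟨b, (mem_polyHull_iff hTc).2 fun q C hC => ?_⟩
  rcases T.eq_empty_or_nonempty with h | ⟨k, hk⟩
  · have := main 1 0 le_rfl (by rw [h]; simp)
    norm_num at this
  · exact main q C ((norm_nonneg _).trans (hC k hk)) hC

end Approximation

lemma eq_zero_of_map_totallyReal_eq_zero {D : (Fin 2 → ℂ) →L[ℂ] ℂ}
    {P : ℝ × ℝ →L[ℝ] (Fin 2 → ℂ)} (hP : Function.Injective P)
    (htr : ∀ v w, P v = Complex.I • P w → P v = 0) (hDP : ∀ v, D (P v) = 0) : D = 0 := by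
  obtain ⟨d, rfl⟩ := exists_eq_linForm D
  by_contra hD
  have hd : d ≠ 0 := by
    rintro rfl
    exact hD (ContinuousLinearMap.ext fun v => by simp)
  set u := P (1, 0) with hu
  set w := P (0, 1) with hw
  have hu0 : u ≠ 0 := fun h => by
    have := congrArg Prod.fst (hP (h.trans (map_zero P).symm))
    simp at this
  have h1 : d 0 * u 0 + d 1 * u 1 = 0 := by rw [← linForm_apply]; exact hDP _
  have h2 : d 0 * w 0 + d 1 * w 1 = 0 := by rw [← linForm_apply]; exact hDP _
  have hdet : u 0 * w 1 - u 1 * w 0 = 0 := by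
    have h3 : d 0 * (u 0 * w 1 - u 1 * w 0) = 0 := by linear_combination w 1 * h1 - u 1 * h2
    have h4 : d 1 * (u 0 * w 1 - u 1 * w 0) = 0 := by linear_combination u 0 * h2 - w 0 * h1
    by_contra hne
    refine hd ?_
    ext i; fin_cases i
    · exact (mul_eq_zero.1 h3).resolve_right hne
    · exact (mul_eq_zero.1 h4).resolve_right hne
  obtain ⟨μ, hμ⟩ : ∃ μ : ℂ, w = μ • u := by
    by_cases h0 : u 0 = 0
    · have h3 : u 1 ≠ 0 := fun h3 => hu0 (by ext i; fin_cases i; exacts [h0, h3])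
      refine ⟨w 1 / u 1, ?_⟩
      ext i; fin_cases i
      · simp only [Fin.zero_eta, Pi.smul_apply, smul_eq_mul]
        field_simp
        linear_combination -hdet
      · simp only [Fin.mk_one, Pi.smul_apply, smul_eq_mul]
        field_simp
    · refine ⟨w 0 / u 0, ?_⟩
      ext i; fin_cases i
      · simp only [Fin.zero_eta, Pi.smul_apply, smul_eq_mul]
        field_simp
      · simp only [Fin.mk_one, Pi.smul_apply, smul_eq_mul]
        field_simp
        linear_combination hdet
  have hkey : P ((0, 1) - μ.re • (1, 0)) = Complex.I • P (μ.im • (1, 0)) := by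
    rw [map_sub, map_smul, map_smul, ← hu, ← hw, hμ]
    ext i
    simp only [Pi.sub_apply, Pi.smul_apply, smul_eq_mul, Complex.real_smul]
    linear_combination -(u i) * Complex.re_add_im μ
  have h3 := congrArg Prod.snd (hP ((htr _ _ hkey).trans (map_zero P).symm))
  simp at h3

lemma eq_on_polyHull_of_eq_on {Ω E : Set (Fin 2 → ℂ)} (hΩ : RungeDomain 2 Ω) (hE : IsCompact E)
    (hEΩ : E ⊆ Ω) {f : (Fin 2 → ℂ) → ℂ} (hf : DifferentiableOn ℂ f Ω) {c : ℂ}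
    (hc : ∀ e ∈ E, f e = c) {z : Fin 2 → ℂ} (hz : z ∈ polyHull 2 E) (hzΩ : z ∈ Ω) : f z = c := by
  have h : PolyApprox (insert z E) fun x => f x + -c := by
    have h1 : PolyApprox (insert z E) f := fun ε hε =>
      hΩ.2.2 f hf _ (insert_subset hzΩ hEΩ) (hE.insert z) ε hε
    have h2 := polyApprox_eval (L := insert z E) (MvPolynomial.C (-c))
    simp only [MvPolynomial.eval_C] at h2
    exact h1.add h2
  have h3 := h.norm_le hE hz (C := 0) fun k hk => by simp [hc k hk]
  exact add_neg_eq_zero.1 (norm_le_zero_iff.1 h3)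

/-- Let `Ω` be a simply connected Runge domain in `ℂ²` and `h`
a real-valued pluriharmonic function on `Ω` (locally the real part of a
holomorphic function). Let `M := {z ∈ Ω : h z = 0}` with `dh(z) ≠ 0` on `M`.
Then every totally real `C²`-smooth disc contained in `M` is polynomially convex. -/
theorem totallyRealDisc_in_pluriharmonic_zeroSet_polyConvex
    (Ω : Set (Fin 2 → ℂ)) (hΩ : RungeDomain 2 Ω)
    (hsc : SimplyConnectedSpace ↥Ω)
    (h : (Fin 2 → ℂ) → ℝ)
    (hpl : ∀ z ∈ Ω, ∃ V : Set (Fin 2 → ℂ), IsOpen V ∧ z ∈ V ∧ V ⊆ Ω ∧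
      ∃ g : (Fin 2 → ℂ) → ℂ, DifferentiableOn ℂ g V ∧ ∀ w ∈ V, h w = (g w).re)
    (M : Set (Fin 2 → ℂ)) (hM : M = {z ∈ Ω | h z = 0})
    (hdh : ∀ z ∈ M, fderiv ℝ h z ≠ 0)
    (K : Set (Fin 2 → ℂ)) (hK : TotallyRealDisc 2 K) (hKM : K ⊆ M) :
    PolyConvex 2 K := by
  obtain ⟨U, φ, hU, hQU, hφ, hinj, hP, htr, rfl⟩ := hK
  obtain ⟨f, hf, hfh⟩ := exists_differentiableOn_re_eq hΩ.1 hpl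
  set Q : Set (ℝ × ℝ) := Metric.closedBall 0 1 with hQ
  have hQc : IsCompact Q := isCompact_closedBall _ _
  have hfC : ∀ z ∈ Ω, ContDiffAt ℂ 1 f z := fun z hz =>
    (contDiffOn_one_of_differentiableOn_complex hf hΩ.1).contDiffAt (hΩ.1.mem_nhds hz)
  have hφC : ∀ y ∈ U, ContDiffAt ℝ 1 φ y := fun y hy =>
    (hφ.contDiffAt (hU.mem_nhds hy)).of_le (by norm_num)
  have hQM : ∀ y ∈ Q, φ y ∈ M := fun y hy => hKM ⟨y, hy, rfl⟩
  have hQΩ : ∀ y ∈ Q, φ y ∈ Ω := fun y hy => (hM ▸ hQM y hy :).1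
  have hfre : ∀ y ∈ Q, (f (φ y)).re = 0 := fun y hy => by
    rw [hfh _ (hQΩ y hy)]; exact (hM ▸ hQM y hy :).2
  have hdf : ∀ y ∈ Q, fderiv ℂ f (φ y) ≠ 0 := by
    intro y hy hzero
    refine hdh _ (hQM y hy) ?_
    have h1 : HasFDerivAt f (fderiv ℂ f (φ y)) (φ y) :=
      ((hfC _ (hQΩ y hy)).differentiableAt one_ne_zero).hasFDerivAt
    have h2 := Complex.reCLM.hasFDerivAt.comp (φ y) (h1.restrictScalars ℝ)
    have h3 : h =ᶠ[𝓝 (φ y)] Complex.reCLM ∘ f := by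
      filter_upwards [hΩ.1.mem_nhds (hQΩ y hy)] with z hz using (hfh z hz).symm
    rw [(h2.congr_of_eventuallyEq h3).fderiv, hzero]
    ext v
    simp
  set U' := U ∩ φ ⁻¹' Ω with hU'
  have hU'o : IsOpen U' := hφ.continuousOn.isOpen_inter_preimage hU hΩ.1
  have hQU' : Q ⊆ U' := fun y hy => ⟨hQU hy, hQΩ y hy⟩
  set g : ℝ × ℝ → ℝ := fun y => (f (φ y)).im with hg
  have hcomp : ∀ y ∈ U', ContDiffAt ℝ 1 (fun y => f (φ y)) y := fun y hy =>
    ContDiffAt.comp (g := f) y ((hfC _ hy.2).restrict_scalars ℝ) (hφC y hy.1)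
  have hgC : ∀ y ∈ U', ContDiffAt ℝ 1 g y := fun y hy =>
    Complex.imCLM.contDiff.contDiffAt.comp y (hcomp y hy)
  have hderiv : ∀ y ∈ Q, HasFDerivAt (fun y => f (φ y))
      (((fderiv ℂ f (φ y)).restrictScalars ℝ).comp (fderiv ℝ φ y)) y := by
    intro y hy
    have h1 : HasFDerivAt f (fderiv ℂ f (φ y)) (φ y) :=
      ((hfC _ (hQΩ y hy)).differentiableAt one_ne_zero).hasFDerivAt
    exact (h1.restrictScalars ℝ).comp y
      ((hφC y (hQU hy)).differentiableAt one_ne_zero).hasFDerivAt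
  have hDP : ∀ y ∈ Q, ∀ v,
      fderiv ℂ f (φ y) (fderiv ℝ φ y v) = Complex.I * fderiv ℝ g y v := by
    intro y hy v
    have hre := (Complex.reCLM.hasFDerivAt.comp y (hderiv y hy)).hasFDerivWithinAt (s := Q)
    have him := Complex.imCLM.hasFDerivAt.comp y (hderiv y hy)
    have hud : UniqueDiffWithinAt ℝ Q y := by
      refine uniqueDiffOn_convex (convex_closedBall _ _) ?_ y hy
      rw [interior_closedBall _ one_ne_zero]
      exact ⟨0, Metric.mem_ball_self one_pos⟩
    have hzero : HasFDerivWithinAt (Complex.reCLM ∘ fun y => f (φ y)) (0 : ℝ × ℝ →L[ℝ] ℝ) Q y :=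
      (hasFDerivWithinAt_const (0 : ℝ) y Q).congr (fun x hx => hfre x hx) (hfre y hy)
    have h1 := DFunLike.congr_fun (hud.eq hre hzero) v
    have h2 : fderiv ℝ g y v = (fderiv ℂ f (φ y) (fderiv ℝ φ y v)).im := by
      have : fderiv ℝ g y = _ := him.fderiv
      rw [this]; rfl
    apply Complex.ext
    · simpa using h1
    · simp [h2]
  have hdg : ∀ y ∈ Q, fderiv ℝ g y ≠ 0 := by
    intro y hy hzero
    refine hdf y hy (eq_zero_of_map_totallyReal_eq_zero (hP y (hQU hy)) (htr y (hQU hy))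
      fun v => ?_)
    rw [hDP y hy v, hzero]
    simp
  have hval : ∀ y ∈ Q, ∀ b : ℝ, f (φ y) = b * Complex.I ↔ g y = b := by
    intro y hy b
    simp [Complex.ext_iff, hfre y hy, hg]
  have hφQ : ContinuousOn φ Q := hφ.continuousOn.mono hQU
  have hK : IsCompact (φ '' Q) := hQc.image_of_continuousOn hφQ
  have hKΩ : φ '' Q ⊆ Ω := by
    rintro _ ⟨y, hy, rfl⟩; exact hQΩ y hy
  refine Subset.antisymm (fun z hz => ?_) (subset_polyHull hK)
  obtain ⟨b, hb⟩ := exists_mem_polyHull_fiber hK (hf.continuousOn.mono hKΩ)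
    (by rintro _ ⟨y, hy, rfl⟩; exact hfre y hy)
    (fun ε hε => hΩ.2.2 f hf _ hKΩ hK ε hε) hz
  set C : Set (ℝ × ℝ) := {y | y ∈ Q ∧ g y = b} with hC
  have hfib : {k | k ∈ φ '' Q ∧ f k = b * Complex.I} = φ '' C := by
    ext k
    constructor
    · rintro ⟨⟨y, hy, rfl⟩, hk⟩
      exact ⟨y, ⟨hy, (hval y hy b).1 hk⟩, rfl⟩
    · rintro ⟨y, ⟨hy, hyb⟩, rfl⟩
      exact ⟨⟨y, hy, rfl⟩, (hval y hy b).2 hyb⟩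
  have hEc : IsCompact (φ '' C) := by
    rw [← hfib]
    exact hK.of_isClosed_subset ((hf.continuousOn.mono hKΩ).preimage_isClosed_of_isClosed
      hK.isClosed (isClosed_singleton (x := (b * Complex.I : ℂ)))) inter_subset_left
  have hCQ : φ '' C ⊆ φ '' Q := image_mono fun y hy => hy.1
  rw [hfib] at hb
  refine hCQ (polyHull_levelSet_subset hΩ.1 hU'o hQU' hfC (fun x hx => hφC x hx.1) hgC
    (hinj.mono hQU) hQΩ (fun y hy => hP y (hQU hy)) hDP hdg hC
    (fun y hy => (hval y hy.1 b).2 hy.2) (fun w hw hwΩ => ?_) hb)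
  refine eq_on_polyHull_of_eq_on hΩ hEc (hCQ.trans hKΩ) hf ?_ hw hwΩ
  rintro _ ⟨y, hy, rfl⟩
  exact (hval y hy.1 b).2 hy.2
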